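/- arXiv:2110.07784 — 8 statements merged into one kernel-verified Lean document; each statement's English description precedes it below -/
import Mathlib

section
/- (Almost path-directed graphs.) Let W be a finite set, let V = W ⊔ ℕ, and let M : V × V → ℕ be a matrix satisfying: (i) for all i, j ∈ ℕ, M(j, i) = 1 if i = j + 1 and M(j, i) = 0 otherwise (entries between the ℕ-part of V); (ii) for all w ∈ W and i ≥ 2, M(w, i) = 0. All other entries (from ℕ to W, within W, and from W to 0 or 1 in ℕ) are arbitrary natural numbers; in particular every row of M has finitely many nonzero entries, so the weighted walk counts f(u, n) are well defined. If for every w ∈ W the power series Σ_{j≥0} M(j, w) x^j ∈ ℚ[[x]] is rational, then for every vertex u ∈ W ∪ {0, 1} the power series Σ_{n≥0} f(u, n) x^n is rational. -/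
/-- A formal power series over `ℚ` is rational if it is the ratio of two
polynomials whose denominator has nonzero constant term. -/
def IsRatPS (g : PowerSeries ℚ) : Prop :=
  ∃ p q : Polynomial ℚ, q.coeff 0 ≠ 0 ∧ (q : PowerSeries ℚ) * g = (p : PowerSeries ℚ)

/-- The number of weighted walks of length `n` starting at a vertex, for a
(possibly infinite) weighted directed graph with weight matrix `M`:
`walkCount M 0 u = 1` and `walkCount M (n+1) u = Σ_v M u v * walkCount M n v`. -/
noncomputable def walkCount {V : Type*} (M : V → V → ℕ) : ℕ → V → ℕ
  | 0 => fun _ => 1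
  | n + 1 => fun u => ∑ᶠ v, M u v * walkCount M n v

/-- The rational power series form a subring. -/
def ratSub : Subring (PowerSeries ℚ) where
  carrier := {g | IsRatPS g}
  mul_mem' := by
    rintro a b ⟨p, q, hq, h⟩ ⟨p', q', hq', h'⟩
    refine ⟨p * p', q * q', ?_, ?_⟩
    · rw [Polynomial.mul_coeff_zero]; exact mul_ne_zero hq hq'
    · push_cast; rw [← h, ← h']; ring
  one_mem' := ⟨1, 1, by simp, by simp⟩
  add_mem' := by
    rintro a b ⟨p, q, hq, h⟩ ⟨p', q', hq', h'⟩
    refine ⟨p * q' + q * p', q * q', ?_, ?_⟩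
    · rw [Polynomial.mul_coeff_zero]; exact mul_ne_zero hq hq'
    · push_cast; rw [← h, ← h']; ring
  zero_mem' := ⟨0, 1, by simp, by simp⟩
  neg_mem' := by
    rintro a ⟨p, q, hq, h⟩
    refine ⟨-p, q, hq, ?_⟩
    rw [mul_neg, h]
    simp

theorem mem_ratSub {g : PowerSeries ℚ} : g ∈ ratSub ↔ IsRatPS g := Iff.rfl

theorem X_mem_ratSub : (PowerSeries.X : PowerSeries ℚ) ∈ ratSub :=
  ⟨Polynomial.X, 1, by simp, by simp⟩

theorem geom_mem_ratSub : (PowerSeries.mk fun _ => (1 : ℚ)) ∈ ratSub := by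
  refine ⟨1, 1 - Polynomial.X, by simp, ?_⟩
  have := PowerSeries.mk_one_mul_one_sub_eq_one ℚ
  rw [mul_comm] at this
  simpa [Pi.one_def] using this

theorem div_mem_ratSub {d g : PowerSeries ℚ} (hd : d ∈ ratSub)
    (h0 : PowerSeries.constantCoeff d ≠ 0) (h : d * g ∈ ratSub) : g ∈ ratSub := by
  obtain ⟨p, q, hq, e⟩ := hd
  obtain ⟨p', q', hq', e'⟩ := h
  refine ⟨q * p', p * q', ?_, ?_⟩
  · rw [Polynomial.mul_coeff_zero]
    refine mul_ne_zero ?_ hq'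
    have := congrArg PowerSeries.constantCoeff e
    rw [map_mul, Polynomial.constantCoeff_coe, Polynomial.constantCoeff_coe] at this
    rw [← this]
    exact mul_ne_zero hq h0
  · push_cast; rw [← e, ← e']; ring

theorem shift_mem_ratSub {a : ℕ → ℚ} (h : PowerSeries.mk a ∈ ratSub) :
    (PowerSeries.mk fun n => a (n + 1)) ∈ ratSub := by
  obtain ⟨p, q, hq, e⟩ := h
  have key : PowerSeries.mk a =
      PowerSeries.X * (PowerSeries.mk fun n => a (n + 1)) + PowerSeries.C (a 0) := by
    ext n
    cases n <;> simp [PowerSeries.coeff_succ_X_mul, PowerSeries.coeff_C]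
  set t : Polynomial ℚ := p - q * Polynomial.C (a 0) with ht
  have et : (t : PowerSeries ℚ) =
      PowerSeries.X * ((q : PowerSeries ℚ) * (PowerSeries.mk fun n => a (n + 1))) := by
    rw [ht, Polynomial.coe_sub, Polynomial.coe_mul, Polynomial.coe_C, ← e, key]
    ring_nf
  have t0 : t.coeff 0 = 0 := by
    rw [← Polynomial.coeff_coe, et]; simp
  have tx := Polynomial.X_mul_divX_add t
  rw [t0, Polynomial.C_0, add_zero] at tx
  refine ⟨t.divX, q, hq, ?_⟩
  apply mul_left_cancel₀ (PowerSeries.X_ne_zero (R := ℚ))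
  rw [← et, ← Polynomial.coe_X, ← Polynomial.coe_mul, tx]

theorem det_mem_ratSub {W : Type} [Fintype W] [DecidableEq W]
    (A : Matrix W W (PowerSeries ℚ)) (hA : ∀ i j, A i j ∈ ratSub) : A.det ∈ ratSub := by
  rw [Matrix.det_apply]
  refine sum_mem fun σ _ => ?_
  rw [Units.smul_def]
  exact zsmul_mem (prod_mem fun i _ => hA _ _) _

/-- A linear system `F = b + X A F` over the rational power series has rational solutions. -/
theorem solve_mem_ratSub {W : Type} [Fintype W]
    (A : W → W → PowerSeries ℚ) (hA : ∀ i j, A i j ∈ ratSub)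
    (b F : W → PowerSeries ℚ) (hb : ∀ i, b i ∈ ratSub)
    (h : ∀ i, F i = b i + PowerSeries.X * ∑ j, A i j * F j) (i : W) : F i ∈ ratSub := by
  classical
  set B : Matrix W W (PowerSeries ℚ) := 1 - (PowerSeries.X : PowerSeries ℚ) • Matrix.of A with hB
  have hBm : ∀ i j, B i j ∈ ratSub := by
    intro i j
    simp only [hB, Matrix.sub_apply, Matrix.smul_apply, Matrix.of_apply, smul_eq_mul,
      Matrix.one_apply]
    refine sub_mem ?_ (mul_mem X_mem_ratSub (hA i j))
    split_ifs
    · exact one_mem _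
    · exact zero_mem _
  have hBF : B.mulVec F = b := by
    funext i
    rw [hB, Matrix.sub_mulVec, Matrix.one_mulVec, Matrix.smul_mulVec]
    simp only [Pi.sub_apply, Pi.smul_apply, Matrix.mulVec, dotProduct, Matrix.of_apply,
      smul_eq_mul]
    rw [sub_eq_iff_eq_add]
    exact h i
  have hcr : B.cramer b = B.det • F := by
    rw [Matrix.cramer_eq_adjugate_mulVec, ← hBF, Matrix.mulVec_mulVec, Matrix.adjugate_mul,
      Matrix.smul_mulVec, Matrix.one_mulVec]
  have hdet0 : PowerSeries.constantCoeff B.det = 1 := by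
    rw [RingHom.map_det]
    have : (PowerSeries.constantCoeff (R := ℚ)).mapMatrix B = 1 := by
      ext i j
      simp [hB, Matrix.one_apply, apply_ite]
    rw [this, Matrix.det_one]
  refine div_mem_ratSub (det_mem_ratSub B hBm) (by rw [hdet0]; exact one_ne_zero) ?_
  have := congrFun hcr i
  rw [Pi.smul_apply, smul_eq_mul] at this
  rw [← this, Matrix.cramer_apply]
  apply det_mem_ratSub
  intro k l
  rw [Matrix.updateCol_apply]
  split_ifs
  · exact hb k
  · exact hBm k l

theorem walk_inr {W : Type} [Fintype W]
    (M : (W ⊕ ℕ) → (W ⊕ ℕ) → ℕ)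
    (h1 : ∀ j i : ℕ, M (.inr j) (.inr i) = if i = j + 1 then 1 else 0) (n j : ℕ) :
    walkCount M (n + 1) (.inr j) = walkCount M n (.inr (j + 1)) +
      ∑ w, M (.inr j) (.inl w) * walkCount M n (.inl w) := by
  classical
  rw [walkCount]; beta_reduce
  rw [finsum_eq_sum_of_support_subset (s := Finset.univ.disjSum {j + 1})]
  · rw [Finset.sum_disjSum]
    simp [h1, add_comm]
  · intro v hv
    rcases v with w | i
    · simp
    · by_cases hi : i = j + 1
      · simp [hi]
      · simp [h1, hi] at hv

theorem walk_inl {W : Type} [Fintype W]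
    (M : (W ⊕ ℕ) → (W ⊕ ℕ) → ℕ)
    (h2 : ∀ (w : W) (i : ℕ), 2 ≤ i → M (.inl w) (.inr i) = 0) (n : ℕ) (w : W) :
    walkCount M (n + 1) (.inl w) = ∑ v, M (.inl w) (.inl v) * walkCount M n (.inl v) +
      (M (.inl w) (.inr 0) * walkCount M n (.inr 0) +
        M (.inl w) (.inr 1) * walkCount M n (.inr 1)) := by
  classical
  rw [walkCount]; beta_reduce
  rw [finsum_eq_sum_of_support_subset (s := Finset.univ.disjSum {0, 1})]
  · rw [Finset.sum_disjSum]
    simp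
  · intro v hv
    rcases v with w | i
    · simp
    · by_cases hi : 2 ≤ i
      · simp [h2 w i hi, h2 _ i hi] at hv
      · have : i = 0 ∨ i = 1 := by omega
        simpa using this

theorem walk_inr_closed {W : Type} [Fintype W]
    (M : (W ⊕ ℕ) → (W ⊕ ℕ) → ℕ)
    (h1 : ∀ j i : ℕ, M (.inr j) (.inr i) = if i = j + 1 then 1 else 0) (n : ℕ) :
    ∀ j, walkCount M (n + 1) (.inr j) = 1 +
      ∑ w, ∑ p ∈ Finset.HasAntidiagonal.antidiagonal n,
        M (.inr (p.1 + j)) (.inl w) * walkCount M p.2 (.inl w) := by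
  induction n with
  | zero => intro j; rw [walk_inr M h1]; simp [walkCount]
  | succ n ih =>
    intro j
    rw [walk_inr M h1, ih]
    simp only [Finset.Nat.sum_antidiagonal_succ, Finset.sum_add_distrib, zero_add]
    rw [add_assoc, add_comm (∑ w, _) (∑ w, _)]
    simp only [add_assoc, add_comm 1 j]

theorem inr_series {W : Type} [Fintype W]
    (M : (W ⊕ ℕ) → (W ⊕ ℕ) → ℕ)
    (h1 : ∀ j i : ℕ, M (.inr j) (.inr i) = if i = j + 1 then 1 else 0) (j : ℕ) :
    (PowerSeries.mk fun n => (walkCount M n (.inr j) : ℚ)) =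
      (PowerSeries.mk fun _ => (1 : ℚ)) + PowerSeries.X *
        ∑ w, (PowerSeries.mk fun k => (M (.inr (k + j)) (.inl w) : ℚ)) *
          (PowerSeries.mk fun n => (walkCount M n (.inl w) : ℚ)) := by
  ext n
  cases n with
  | zero => simp [walkCount]
  | succ n =>
    rw [map_add, PowerSeries.coeff_succ_X_mul, map_sum]
    simp only [PowerSeries.coeff_mul, PowerSeries.coeff_mk]
    rw [walk_inr_closed M h1]
    push_cast
    rfl

theorem inl_series {W : Type} [Fintype W]
    (M : (W ⊕ ℕ) → (W ⊕ ℕ) → ℕ)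
    (h2 : ∀ (w : W) (i : ℕ), 2 ≤ i → M (.inl w) (.inr i) = 0) (w : W) :
    (PowerSeries.mk fun n => (walkCount M n (.inl w) : ℚ)) =
      1 + PowerSeries.X *
        (∑ v, (M (.inl w) (.inl v) : PowerSeries ℚ) *
            (PowerSeries.mk fun n => (walkCount M n (.inl v) : ℚ)) +
          ((M (.inl w) (.inr 0) : PowerSeries ℚ) *
              (PowerSeries.mk fun n => (walkCount M n (.inr 0) : ℚ)) +
            (M (.inl w) (.inr 1) : PowerSeries ℚ) *
              (PowerSeries.mk fun n => (walkCount M n (.inr 1) : ℚ)))) := by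
  have hc : ∀ (m n : ℕ) (g : PowerSeries ℚ),
      PowerSeries.coeff n ((m : PowerSeries ℚ) * g) = m * PowerSeries.coeff n g := by
    intro m n g
    rw [← nsmul_eq_mul, map_nsmul, nsmul_eq_mul]
  ext n
  cases n with
  | zero => simp [walkCount]
  | succ n =>
    rw [map_add, PowerSeries.coeff_succ_X_mul, map_add, map_add, map_sum]
    simp only [hc, PowerSeries.coeff_mk]
    rw [walk_inl M h2]
    push_cast
    simp [PowerSeries.coeff_one]

/-- Almost path-directed graphs: the vertex set is `W ⊔ ℕ` with `W` finite; within
the `ℕ`-part the only edges are `j → j+1` (each once); vertices of `W` have no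
edges into `ℕ`-vertices `≥ 2`.  If for each `w ∈ W` the series `Σ_j M(j,w) xʲ`
is rational, then the walk-counting generating function from any vertex of
`W ∪ {0, 1}` is rational. -/
theorem almost_path_directed_rational {W : Type} [Fintype W]
    (M : (W ⊕ ℕ) → (W ⊕ ℕ) → ℕ)
    (h1 : ∀ j i : ℕ, M (.inr j) (.inr i) = if i = j + 1 then 1 else 0)
    (h2 : ∀ (w : W) (i : ℕ), 2 ≤ i → M (.inl w) (.inr i) = 0)
    (hrat : ∀ w : W, IsRatPS (PowerSeries.mk fun j => (M (.inr j) (.inl w) : ℚ)))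
    (u : W ⊕ ℕ) (hu : (∃ w, u = .inl w) ∨ u = .inr 0 ∨ u = .inr 1) :
    IsRatPS (PowerSeries.mk fun n => (walkCount M n u : ℚ)) := by
  have hR0 : ∀ w : W, (PowerSeries.mk fun k => (M (.inr (k + 0)) (.inl w) : ℚ)) ∈ ratSub :=
    fun w => hrat w
  have hR1 : ∀ w : W, (PowerSeries.mk fun k => (M (.inr (k + 1)) (.inl w) : ℚ)) ∈ ratSub :=
    fun w => shift_mem_ratSub (a := fun k => (M (.inr k) (.inl w) : ℚ)) (hrat w)
  have hinl : ∀ w : W, (PowerSeries.mk fun n => (walkCount M n (.inl w) : ℚ)) ∈ ratSub := by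
    refine solve_mem_ratSub
      (fun w v => (M (.inl w) (.inl v) : PowerSeries ℚ) + PowerSeries.X *
        ((M (.inl w) (.inr 0) : PowerSeries ℚ) *
            (PowerSeries.mk fun k => (M (.inr (k + 0)) (.inl v) : ℚ)) +
          (M (.inl w) (.inr 1) : PowerSeries ℚ) *
            (PowerSeries.mk fun k => (M (.inr (k + 1)) (.inl v) : ℚ)))) ?_
      (fun w => 1 + PowerSeries.X * (((M (.inl w) (.inr 0) : PowerSeries ℚ) +
        (M (.inl w) (.inr 1) : PowerSeries ℚ)) * (PowerSeries.mk fun _ => (1 : ℚ)))) _ ?_ ?_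
    · intro w v
      exact add_mem (natCast_mem _ _) (mul_mem X_mem_ratSub
        (add_mem (mul_mem (natCast_mem _ _) (hR0 v)) (mul_mem (natCast_mem _ _) (hR1 v))))
    · intro w
      exact add_mem (one_mem _) (mul_mem X_mem_ratSub
        (mul_mem (add_mem (natCast_mem _ _) (natCast_mem _ _)) geom_mem_ratSub))
    · intro w
      beta_reduce
      rw [inl_series M h2 w, inr_series M h1 0, inr_series M h1 1]
      simp only [add_mul, mul_add, Finset.sum_add_distrib, Finset.mul_sum, mul_assoc,
        mul_left_comm _ (PowerSeries.X : PowerSeries ℚ)]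
      ring
  have hinr : ∀ j, (∀ w : W,
      (PowerSeries.mk fun k => (M (.inr (k + j)) (.inl w) : ℚ)) ∈ ratSub) →
      (PowerSeries.mk fun n => (walkCount M n (.inr j) : ℚ)) ∈ ratSub := by
    intro j hj
    rw [inr_series M h1 j]
    exact add_mem geom_mem_ratSub (mul_mem X_mem_ratSub
      (sum_mem fun w _ => mul_mem (hj w) (hinl w)))
  rcases hu with ⟨w, rfl⟩ | rfl | rfl
  · exact hinl w
  · exact hinr 0 hR0
  · exact hinr 1 hR1
end

section
/- (Directed graphs with α-growing paths.) Let α ≥ 2, let W be a finite set, and let V = W ⊔ ([α] × ℕ). Fix natural numbers r_1, …, r_α, r'_α, natural numbers r_{s,1}, r_{s,2} for each 2 ≤ s ≤ α−1, numbers r_{α,1}, …, r_{α,α} ∈ {0,1}, and for each 2 ≤ s ≤ α an index s' with 1 ≤ s' < s (write α' for the index assigned to s = α). Let M : V × V → ℕ satisfy, for every k ≥ 0: (a) M((1,k),(1,i)) = 1 if i < k, = r_1 if i = k, = 0 if i > k, and M((1,k),(j,i)) = 0 for all j ≠ 1; (b) for 2 ≤ s ≤ α−1: M((s,k),(s',i))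 = 1 if i < k, = r_s if i = k, = r_{s,1} if i = k+1, = 0 if i > k+1; M((s,k),(s,k)) = r_{s,2}; and M((s,k),(j,i)) = 0 for every other pair (j,i) in [α] × ℕ; (c) M((α,k),(α',i)) = 1 if i < k and = r_α if i = k; M((α,k),(α,k)) = r'_α; M((α,k),(j,k+1)) = r_{α,j} for each j ∈ [α]; and M((α,k),(j,i)) = 0 for every other pair (j,i) in [α] × ℕ; (d) M(w,(j,i)) = 0 for every w ∈ W and i ≥ 2. All entries from [α] × ℕ into W, within W, and from W into [α] × {0,1} are arbitrary natural numbers (so every row of M has finitely many nonzero entries and the weighted walk counts f(u, n) are well defined). If for every s ∈ [α] and w ∈ W the power series Σ_{k≥0} M((s,k), w) x^k ∈ ℚ[[x]] is rational, then for every vertex u ∈ W ∪ ([α] × {0,1}) the power series Σ_{n≥0} f(u, n) x^n is rational. -/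
open PowerSeries in
/-- The subring of rational power series. -/
def ratSubring : Subring (PowerSeries ℚ) where
  carrier := {g | IsRatPS g}
  mul_mem' := by
    rintro a b ⟨p, q, hq, h⟩ ⟨p', q', hq', h'⟩
    refine ⟨p * p', q * q', ?_, ?_⟩
    · rw [Polynomial.mul_coeff_zero]; exact mul_ne_zero hq hq'
    · push_cast; rw [← h, ← h']; ring
  one_mem' := ⟨1, 1, by simp, by simp⟩
  add_mem' := by
    rintro a b ⟨p, q, hq, h⟩ ⟨p', q', hq', h'⟩
    refine ⟨q' * p + q * p', q * q', ?_, ?_⟩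
    · rw [Polynomial.mul_coeff_zero]; exact mul_ne_zero hq hq'
    · push_cast; rw [← h, ← h']; ring
  zero_mem' := ⟨0, 1, by simp, by simp⟩
  neg_mem' := by
    rintro a ⟨p, q, hq, h⟩
    exact ⟨-p, q, hq, by push_cast; rw [← h]; ring⟩

theorem ratX : PowerSeries.X ∈ ratSubring := ⟨Polynomial.X, 1, by simp, by simp⟩

theorem ratC (c : ℚ) : PowerSeries.C c ∈ ratSubring :=
  ⟨Polynomial.C c, 1, by simp, by simp⟩

theorem rat_inv {c : PowerSeries ℚ} (hc : c ∈ ratSubring)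
    (h0 : PowerSeries.constantCoeff c ≠ 0) : ∃ u ∈ ratSubring, c * u = 1 := by
  obtain ⟨p, q, hq, h⟩ := hc
  have hcc : c * c⁻¹ = 1 := PowerSeries.mul_inv_cancel c h0
  refine ⟨c⁻¹, ⟨q, p, ?_, ?_⟩, hcc⟩
  · have := congrArg PowerSeries.constantCoeff h
    rw [map_mul, Polynomial.constantCoeff_coe, Polynomial.constantCoeff_coe] at this
    rw [← this]; exact mul_ne_zero hq h0
  · rw [← h, mul_assoc, hcc, mul_one]

theorem rat_aeval {Y : PowerSeries ℚ} (hY : Y ∈ ratSubring) (p : Polynomial ℚ) :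
    Polynomial.aeval Y p ∈ ratSubring := by
  rw [Polynomial.aeval_eq_sum_range]
  refine Subring.sum_mem _ fun i _ => ?_
  rw [PowerSeries.smul_eq_C_mul]
  exact Subring.mul_mem _ (ratC _) (Subring.pow_mem _ hY _)

theorem smul_memS (S : Submodule ratSubring (PowerSeries ℚ)) {c a : PowerSeries ℚ}
    (hc : c ∈ ratSubring) (ha : a ∈ S) : c * a ∈ S :=
  S.smul_mem (⟨c, hc⟩ : ratSubring) ha

/-- Sequences `a` for which `t k = a k + Y * t (k+1)` has a solution in `S`. -/
def GoodSeq (S : Submodule ratSubring (PowerSeries ℚ)) (Y : PowerSeries ℚ)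
    (a : ℕ → PowerSeries ℚ) : Prop :=
  ∃ t : ℕ → PowerSeries ℚ, (∀ k, t k ∈ S) ∧ ∀ k, t k = a k + Y * t (k + 1)

namespace GoodSeq
variable {S : Submodule ratSubring (PowerSeries ℚ)} {Y : PowerSeries ℚ}
  {a b : ℕ → PowerSeries ℚ}

theorem mem (hY : Y ∈ ratSubring) (ha : GoodSeq S Y a) (k : ℕ) : a k ∈ S := by
  obtain ⟨t, ht, h⟩ := ha
  have : a k = t k - Y * t (k + 1) := by rw [h k]; ring
  rw [this]
  exact S.sub_mem (ht _) (smul_memS S hY (ht _))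

theorem add (ha : GoodSeq S Y a) (hb : GoodSeq S Y b) : GoodSeq S Y (fun k => a k + b k) := by
  obtain ⟨t, ht, h⟩ := ha
  obtain ⟨t', ht', h'⟩ := hb
  exact ⟨fun k => t k + t' k, fun k => S.add_mem (ht k) (ht' k), fun k => by
    simp only; rw [h k, h' k]; ring⟩

theorem smul {c : PowerSeries ℚ} (hc : c ∈ ratSubring) (ha : GoodSeq S Y a) :
    GoodSeq S Y (fun k => c * a k) := by
  obtain ⟨t, ht, h⟩ := ha
  exact ⟨fun k => c * t k, fun k => smul_memS S hc (ht k), fun k => by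
    simp only; rw [h k]; ring⟩

theorem shift (ha : GoodSeq S Y a) : GoodSeq S Y (fun k => a (k + 1)) := by
  obtain ⟨t, ht, h⟩ := ha
  exact ⟨fun k => t (k + 1), fun k => ht _, fun k => h _⟩

theorem zero : GoodSeq S Y (fun _ => 0) := ⟨fun _ => 0, fun _ => S.zero_mem, by simp⟩

theorem sum {ι : Type*} (s : Finset ι) (f : ι → ℕ → PowerSeries ℚ)
    (hf : ∀ i ∈ s, GoodSeq S Y (f i)) : GoodSeq S Y (fun k => ∑ i ∈ s, f i k) := by
  classical
  induction s using Finset.induction_on with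
  | empty => simpa using zero
  | insert i s hi ih =>
    simp only [Finset.sum_insert hi]
    exact add (hf i (Finset.mem_insert_self _ _))
      (ih fun j hj => hf j (Finset.mem_insert_of_mem hj))

theorem recur (hY : Y ∈ ratSubring) (hY0 : PowerSeries.constantCoeff Y = 0)
    {c : PowerSeries ℚ} (hc : c ∈ ratSubring) (h0 : a 0 ∈ S) (hb : GoodSeq S Y b)
    (h : ∀ k, a (k + 1) = c * a k + b k) : GoodSeq S Y a := by
  have haS : ∀ k, a k ∈ S := by
    intro k
    induction k with
    | zero => exact h0
    | succ k ih => rw [h]; exact S.add_mem (smul_memS S hc ih) (hb.mem hY k)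
  obtain ⟨t, ht, h'⟩ := hb
  obtain ⟨u, hu, hcu⟩ := rat_inv (c := 1 - c * Y)
    (Subring.sub_mem _ (Subring.one_mem _) (Subring.mul_mem _ hc hY)) (by simp [hY0])
  refine ⟨fun k => u * (a k + Y * t k), fun k => smul_memS S hu
    (S.add_mem (haS k) (smul_memS S hY (ht k))), fun k => ?_⟩
  simp only
  rw [h k, h' k]
  linear_combination (a k) * hcu

theorem const (hY : Y ∈ ratSubring) (hY0 : PowerSeries.constantCoeff Y = 0)
    {c : PowerSeries ℚ} (hc : c ∈ S) : GoodSeq S Y (fun _ => c) :=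
  recur hY hY0 (Subring.one_mem _) hc zero (by simp)

theorem psum (hY : Y ∈ ratSubring) (hY0 : PowerSeries.constantCoeff Y = 0)
    (ha : GoodSeq S Y a) : GoodSeq S Y (fun k => ∑ i ∈ Finset.range k, a i) :=
  recur hY hY0 (Subring.one_mem _) (by simp) ha
    (by intro k; rw [Finset.sum_range_succ]; ring)

theorem ratSeq (hY : Y ∈ ratSubring) (hY0 : PowerSeries.constantCoeff Y = 0)
    {m : ℕ → ℚ} (hm : IsRatPS (PowerSeries.mk m)) {c : PowerSeries ℚ} (hc : c ∈ S) :
    GoodSeq S Y (fun k => PowerSeries.C (m k) * c) := by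
  obtain ⟨p, q, hq, h⟩ := hm
  have hmk : ∀ k, (PowerSeries.mk fun i => m (k + i)) =
      PowerSeries.C (m k) + PowerSeries.X * PowerSeries.mk fun i => m (k + 1 + i) := by
    intro k
    ext n
    cases n with
    | zero => simp
    | succ n => 
      simp [PowerSeries.coeff_succ_X_mul, PowerSeries.coeff_C]
      congr 1; ring
  have key : ∀ k, ∃ P : Polynomial ℚ,
      (q : PowerSeries ℚ) * PowerSeries.mk (fun i => m (k + i)) = (P : PowerSeries ℚ) := by
    intro k
    induction k with
    | zero => exact ⟨p, by simpa using h⟩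
    | succ k ih =>
      obtain ⟨P, hP⟩ := ih
      rw [hmk k] at hP
      refine ⟨(P - Polynomial.C (m k) * q).divX, ?_⟩
      have h0 : (P - Polynomial.C (m k) * q).coeff 0 = 0 := by
        have := congrArg PowerSeries.constantCoeff hP
        simp at this
        simp [← this]; ring
      have h1 := Polynomial.divX_mul_X_add (P - Polynomial.C (m k) * q)
      rw [h0, map_zero, add_zero] at h1
      have h2 := congrArg (fun z : Polynomial ℚ => (z : PowerSeries ℚ)) h1
      simp only [Polynomial.coe_mul, Polynomial.coe_sub, Polynomial.coe_X, Polynomial.coe_C] at h2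
      have h3 : (PowerSeries.X : PowerSeries ℚ) ≠ 0 := PowerSeries.X_ne_zero
      apply mul_right_cancel₀ h3
      rw [h2, ← hP]; ring
  choose P hP using key
  have hrec : ∀ k, P k = Polynomial.C (m k) * q + Polynomial.X * P (k + 1) := by
    intro k
    apply Polynomial.coe_injective
    push_cast
    rw [← hP, ← hP, hmk k]; ring
  obtain ⟨u, hu, hcu⟩ := rat_inv (rat_aeval hY q) (by
    have : PowerSeries.constantCoeff (Polynomial.aeval Y q) = q.coeff 0 := by
      rw [Polynomial.aeval_def, Polynomial.hom_eval₂, hY0, Polynomial.eval₂_at_zero]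
      simp
    rw [this]; exact hq)
  refine ⟨fun k => u * Polynomial.aeval Y (P k) * c, fun k =>
    smul_memS S (Subring.mul_mem _ hu (rat_aeval hY _)) hc, fun k => ?_⟩
  simp only
  rw [hrec k]
  simp only [map_add, map_mul, Polynomial.aeval_C, Polynomial.aeval_X]
  have : (algebraMap ℚ (PowerSeries ℚ)) (m k) = PowerSeries.C (m k) := rfl
  rw [this]
  linear_combination (PowerSeries.C (m k) * c) * hcu

theorem solve (hY0 : PowerSeries.X ∣ Y) (hb : GoodSeq S Y b)
    (h : ∀ k, a k = b k + Y * a (k + 1)) (k : ℕ) : a k ∈ S := by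
  obtain ⟨t, ht, h'⟩ := hb
  have h1 : ∀ n k, PowerSeries.X ^ n ∣ a k - t k := by
    intro n
    induction n with
    | zero => simp
    | succ n ih =>
      intro k
      have : a k - t k = Y * (a (k + 1) - t (k + 1)) := by rw [h k, h' k]; ring
      rw [this, pow_succ']
      exact mul_dvd_mul hY0 (ih _)
  have : a k = t k := by
    rw [← sub_eq_zero]
    ext n
    exact PowerSeries.X_pow_dvd_iff.1 (h1 (n + 1) k) n (Nat.lt_succ_self n)
  rw [this]; exact ht k

end GoodSeq

theorem nakayama_rat (S : Submodule ratSubring (PowerSeries ℚ)) (hfg : S.FG)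
    (h : ∀ a ∈ S, ∃ c ∈ ratSubring, ∃ s ∈ S, a = c + PowerSeries.X * s) :
    ∀ a ∈ S, IsRatPS a := by
  let x : ratSubring := ⟨PowerSeries.X, ratX⟩
  have hj : Ideal.span {x} ≤ Ideal.jacobson ⊥ := by
    rw [Ideal.span_singleton_le_iff_mem, Ideal.mem_jacobson_bot]
    intro y
    obtain ⟨u, hu, hcu⟩ := rat_inv (x * y + 1).2 (by simp [x])
    exact IsUnit.of_mul_eq_one ⟨u, hu⟩ (Subtype.ext hcu)
  have hle : S ≤ (Submodule.span ratSubring {(1 : PowerSeries ℚ)}) := by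
    refine Submodule.le_of_le_smul_of_le_jacobson_bot hfg hj ?_
    intro a ha
    obtain ⟨c, hc, s, hs, rfl⟩ := h a ha
    refine Submodule.add_mem_sup ?_ ?_
    · exact Submodule.mem_span_singleton.2 ⟨⟨c, hc⟩, by
        change c * 1 = c
        simp⟩
    · exact Submodule.smul_mem_smul (r := x) (Ideal.mem_span_singleton_self x) hs
  intro a ha
  obtain ⟨c, hc⟩ := Submodule.mem_span_singleton.1 (hle ha)
  have : (c : PowerSeries ℚ) * 1 = a := hc
  rw [← this, mul_one]
  exact c.2

/-- The walk generating function. -/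
noncomputable def walkGF {V : Type*} (M : V → V → ℕ) (u : V) : PowerSeries ℚ :=
  PowerSeries.mk fun n => (walkCount M n u : ℚ)

theorem walkGF_eq {W : Type} [Fintype W] {α : ℕ}
    (M : (W ⊕ (Fin α × ℕ)) → (W ⊕ (Fin α × ℕ)) → ℕ) (u : W ⊕ (Fin α × ℕ)) (N : ℕ)
    (hN : ∀ j i, N ≤ i → M u (.inr (j, i)) = 0) :
    walkGF M u = 1 + PowerSeries.X * (∑ w, PowerSeries.C (M u (.inl w) : ℚ) * walkGF M (.inl w)
      + ∑ j, ∑ i ∈ Finset.range N,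
        PowerSeries.C (M u (.inr (j, i)) : ℚ) * walkGF M (.inr (j, i))) := by
  classical
  ext n
  cases n with
  | zero => simp [walkGF, walkCount]
  | succ n =>
    have : walkCount M (n + 1) u = ∑ w, M u (.inl w) * walkCount M n (.inl w)
        + ∑ j, ∑ i ∈ Finset.range N, M u (.inr (j, i)) * walkCount M n (.inr (j, i)) := by
      simp only [walkCount]
      rw [finsum_eq_sum_of_support_subset (s := (Finset.univ : Finset W).disjSum
        ((Finset.univ : Finset (Fin α)) ×ˢ Finset.range N)), Finset.sum_disjSum,
        Finset.sum_product]
      intro v hv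
      rcases v with w | ⟨j, i⟩
      · simp
      · simp only [Function.mem_support] at hv
        rw [Finset.mem_coe]
        by_contra hcon
        apply hv
        rw [hN j i (by simpa using hcon), zero_mul]
    simp only [walkGF, PowerSeries.coeff_mk, this, map_add, PowerSeries.coeff_succ_X_mul, map_sum,
      PowerSeries.coeff_C_mul]
    push_cast
    simp [PowerSeries.coeff_one]

/-- Directed graphs with `α`-growing paths.  The vertex set is `W ⊔ (Fin α × ℕ)`
with `W` finite; the element `s : Fin α` represents the index `s + 1 ∈ [α]`, so
`⟨0, _⟩` represents `1` and `⟨α - 1, _⟩` represents `α`.  The map `s'` assigns to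
each index `s` with `s.1 ≠ 0` an index `s' s < s`.  Hypotheses `ha, ha'`
encode rule (a) (for the first family), `hb, hb2, hb0` rule (b) (for the middle
families), `hc, hc2, hc3, hc0` rule (c) (for the last family), and `hd` rule (d).
If the series `Σ_k M((s,k), w) xᵏ` is rational for all `s ∈ [α]` and `w ∈ W`,
then the walk-counting generating function from any vertex of
`W ∪ ([α] × {0, 1})` is rational. -/
theorem alpha_growing_paths_rational {W : Type} [Fintype W]
    (α : ℕ) (hα : 2 ≤ α)
    (M : (W ⊕ (Fin α × ℕ)) → (W ⊕ (Fin α × ℕ)) → ℕ)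
    (r r1 r2 : Fin α → ℕ) (rα' : ℕ)
    (rr : Fin α → ℕ) (hrr : ∀ j : Fin α, rr j ≤ 1)
    (s' : Fin α → Fin α) (hs' : ∀ j : Fin α, j.1 ≠ 0 → s' j < j)
    -- rule (a): the first family
    (ha : ∀ k i : ℕ, M (.inr (⟨0, by omega⟩, k)) (.inr (⟨0, by omega⟩, i)) =
        if i < k then 1 else if i = k then r ⟨0, by omega⟩ else 0)
    (ha' : ∀ (k i : ℕ) (j : Fin α), j.1 ≠ 0 →
        M (.inr (⟨0, by omega⟩, k)) (.inr (j, i)) = 0)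
    -- rule (b): the middle families `2 ≤ s ≤ α - 1`
    (hb : ∀ s : Fin α, s.1 ≠ 0 → s.1 ≠ α - 1 → ∀ k i : ℕ,
        M (.inr (s, k)) (.inr (s' s, i)) =
          if i < k then 1 else if i = k then r s else if i = k + 1 then r1 s else 0)
    (hb2 : ∀ s : Fin α, s.1 ≠ 0 → s.1 ≠ α - 1 → ∀ k : ℕ,
        M (.inr (s, k)) (.inr (s, k)) = r2 s)
    (hb0 : ∀ s : Fin α, s.1 ≠ 0 → s.1 ≠ α - 1 → ∀ (k : ℕ) (j : Fin α) (i : ℕ),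
        ¬(j = s' s ∧ i ≤ k + 1) → ¬(j = s ∧ i = k) →
        M (.inr (s, k)) (.inr (j, i)) = 0)
    -- rule (c): the last family `s = α`
    (hc : ∀ k i : ℕ, i ≤ k →
        M (.inr (⟨α - 1, by omega⟩, k)) (.inr (s' ⟨α - 1, by omega⟩, i)) =
          if i < k then 1 else r ⟨α - 1, by omega⟩)
    (hc2 : ∀ k : ℕ, M (.inr (⟨α - 1, by omega⟩, k)) (.inr (⟨α - 1, by omega⟩, k)) = rα')
    (hc3 : ∀ (k : ℕ) (j : Fin α),
        M (.inr (⟨α - 1, by omega⟩, k)) (.inr (j, k + 1)) = rr j)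
    (hc0 : ∀ (k : ℕ) (j : Fin α) (i : ℕ),
        ¬(j = s' ⟨α - 1, by omega⟩ ∧ i ≤ k) → ¬(j = ⟨α - 1, by omega⟩ ∧ i = k) →
        i ≠ k + 1 →
        M (.inr (⟨α - 1, by omega⟩, k)) (.inr (j, i)) = 0)
    -- rule (d): `W`-vertices have no edges into `(j, i)` with `i ≥ 2`
    (hd : ∀ (w : W) (j : Fin α) (i : ℕ), 2 ≤ i → M (.inl w) (.inr (j, i)) = 0)
    (hrat : ∀ (s : Fin α) (w : W),
        IsRatPS (PowerSeries.mk fun k => (M (.inr (s, k)) (.inl w) : ℚ)))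
    (u : W ⊕ (Fin α × ℕ))
    (hu : (∃ w, u = .inl w) ∨ ∃ (j : Fin α) (i : ℕ), i ≤ 1 ∧ u = .inr (j, i)) :
    IsRatPS (PowerSeries.mk fun n => (walkCount M n u : ℚ)) := by
  classical
  set z : Fin α := ⟨0, by omega⟩ with hz
  set e : Fin α := ⟨α - 1, by omega⟩ with he
  have hze : e.1 ≠ 0 := by simp [he]; omega
  have hee : s' e ≠ e := (hs' e hze).ne
  let F : Fin α → ℕ → PowerSeries ℚ := fun j i => walkGF M (.inr (j, i))
  let S : Submodule ratSubring (PowerSeries ℚ) :=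
    Submodule.span ratSubring (insert 1 (Set.range fun w : W => walkGF M (.inl w)))
  have hfg : S.FG := Submodule.fg_span ((Set.finite_range _).insert _)
  have h1S : (1 : PowerSeries ℚ) ∈ S := Submodule.subset_span (Set.mem_insert _ _)
  have hWS : ∀ w, walkGF M (.inl w) ∈ S := fun w =>
    Submodule.subset_span (Set.mem_insert_of_mem _ ⟨w, rfl⟩)
  have hinv : ∀ c : ℕ, ∃ v ∈ ratSubring,
      (1 - PowerSeries.C (c : ℚ) * PowerSeries.X) * v = 1 := fun c =>
    rat_inv (Subring.sub_mem _ (Subring.one_mem _) (Subring.mul_mem _ (ratC _) ratX)) (by simp)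
  choose v hv hv1 using hinv
  obtain ⟨Y, hYdef⟩ : ∃ Y, Y = PowerSeries.X * (PowerSeries.C (rr e : ℚ) * v rα') := ⟨_, rfl⟩
  have hYX : PowerSeries.X ∣ Y := ⟨_, hYdef⟩
  have hY : Y ∈ ratSubring := by
    rw [hYdef]; exact Subring.mul_mem _ ratX (Subring.mul_mem _ (ratC _) (hv _))
  have hY0 : PowerSeries.constantCoeff Y = 0 := PowerSeries.X_dvd_iff.1 hYX
  -- the inhomogeneous part
  let B : Fin α → ℕ → PowerSeries ℚ := fun s k =>
    1 + PowerSeries.X * ∑ w, PowerSeries.C (M (.inr (s, k)) (.inl w) : ℚ) * walkGF M (.inl w)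
  have hB : ∀ s, GoodSeq S Y (B s) := fun s =>
    (GoodSeq.const hY hY0 h1S).add (GoodSeq.smul ratX (GoodSeq.sum _ _ fun w _ =>
      GoodSeq.ratSeq hY hY0 (hrat s w) (hWS w)))
  -- first family
  have hF0 : ∀ k, F z k = B z k + PowerSeries.X * (∑ i ∈ Finset.range k, F z i
      + PowerSeries.C (r z : ℚ) * F z k) := by
    intro k
    have h := walkGF_eq M (.inr (z, k)) (k + 1) (by
      intro j i hi
      by_cases hj : j = z
      · subst hj; rw [ha, if_neg (by omega), if_neg (by omega)]
      · exact ha' k i j (fun h => hj (Fin.ext h)))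
    rw [Finset.sum_eq_single z (fun j _ hj => Finset.sum_eq_zero fun i _ => by
      rw [ha' k i j (fun h => hj (Fin.ext h))]; simp) (by simp), Finset.sum_range_succ,
      Finset.sum_congr rfl (g := fun i => F z i) (fun i hi => by
        rw [ha, if_pos (Finset.mem_range.1 hi)]; simp [F]), ha, if_neg (by omega),
        if_pos rfl] at h
    simp only [F, B] at h ⊢
    refine h.trans ?_; ring
  have hG0 : GoodSeq S Y (F z) := by
    refine GoodSeq.recur hY hY0 (c := 1 + PowerSeries.X * v (r z))
      (Subring.add_mem _ (Subring.one_mem _) (Subring.mul_mem _ ratX (hv _))) ?_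
      (GoodSeq.smul (hv (r z)) ((hB z).shift.add (GoodSeq.smul (c := -1)
        (Subring.neg_mem _ (Subring.one_mem _)) (hB z)))) ?_
    · have h := hF0 0
      have : F z 0 = v (r z) * B z 0 := by
        rw [Finset.range_zero, Finset.sum_empty] at h
        linear_combination v (r z) * h - F z 0 * hv1 (r z)
      rw [this]
      exact smul_memS S (hv _) ((hB z).mem hY 0)
    · intro k
      have h := hF0 k
      have h' := hF0 (k + 1)
      rw [Finset.sum_range_succ] at h'
      linear_combination v (r z) * h' - v (r z) * h - (F z (k + 1) - F z k) * hv1 (r z)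
  -- middle families
  have hFm : ∀ s : Fin α, s.1 ≠ 0 → s ≠ e → ∀ k, F s k = B s k + PowerSeries.X *
      (∑ i ∈ Finset.range k, F (s' s) i + PowerSeries.C (r s : ℚ) * F (s' s) k
        + PowerSeries.C (r1 s : ℚ) * F (s' s) (k + 1) + PowerSeries.C (r2 s : ℚ) * F s k) := by
    intro s hs0 hse k
    have hse' : s.1 ≠ α - 1 := fun h => hse (Fin.ext h)
    have hne : s' s ≠ s := (hs' s hs0).ne
    have h := walkGF_eq M (.inr (s, k)) (k + 2) (by
      intro j i hi
      exact hb0 s hs0 hse' k j i (by rintro ⟨_, h⟩; omega) (by rintro ⟨_, h⟩; omega))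
    have hsum : (∑ j, ∑ i ∈ Finset.range (k + 2),
        PowerSeries.C (M (.inr (s, k)) (.inr (j, i)) : ℚ) * walkGF M (.inr (j, i))) =
        (∑ i ∈ Finset.range k, F (s' s) i + PowerSeries.C (r s : ℚ) * F (s' s) k
        + PowerSeries.C (r1 s : ℚ) * F (s' s) (k + 1)) + PowerSeries.C (r2 s : ℚ) * F s k := by
      rw [Finset.sum_eq_add (s' s) s hne]
      · congr 1
        · rw [Finset.sum_range_succ, Finset.sum_range_succ,
            Finset.sum_congr rfl (g := fun i => F (s' s) i) (fun i hi => by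
              rw [hb s hs0 hse', if_pos (Finset.mem_range.1 hi)]; simp [F])]
          rw [hb s hs0 hse', hb s hs0 hse']
          simp [F]
        · rw [Finset.sum_eq_single k]
          · rw [hb2 s hs0 hse']
          · intro i _ hi
            rw [hb0 s hs0 hse' k s i (fun h => hne h.1.symm) (fun h => hi h.2)]; simp
          · simp
      · intro j _ hj
        refine Finset.sum_eq_zero fun i _ => ?_
        rw [hb0 s hs0 hse' k j i (fun h => hj.1 h.1) (fun h => hj.2 h.1)]; simp
      · simp
      · simp
    rw [hsum] at h
    simp only [F, B] at h ⊢
    refine h.trans ?_; ring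
  have hG : ∀ n, ∀ s : Fin α, s.1 = n → s ≠ e → GoodSeq S Y (F s) := by
    intro n
    induction n using Nat.strong_induction_on with
    | _ n ih =>
      intro s hsn hse
      by_cases hs0 : s.1 = 0
      · have : s = z := Fin.ext hs0
        rw [this]; exact hG0
      · have hlt : s' s < s := hs' s hs0
        have hg := ih (s' s).1 (by rw [← hsn]; exact hlt) (s' s) rfl (by
          intro h
          have h2 : (s' s).1 < s.1 := hlt
          have h3 := s.2
          rw [h] at h2
          simp only [he] at h2
          omega)
        have := GoodSeq.smul (hv (r2 s)) ((hB s).add (GoodSeq.smul ratX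
          (((GoodSeq.psum hY hY0 hg).add (GoodSeq.smul (ratC (r s : ℚ)) hg)).add
            (GoodSeq.smul (ratC (r1 s : ℚ)) hg.shift))))
        convert this using 1
        funext k
        have h := hFm s hs0 hse k
        linear_combination v (r2 s) * h - F s k * hv1 (r2 s)
  -- last family
  have hFe : ∀ k, F e k = B e k + PowerSeries.X *
      (∑ i ∈ Finset.range k, F (s' e) i + PowerSeries.C (r e : ℚ) * F (s' e) k
        + PowerSeries.C (rα' : ℚ) * F e k
        + ∑ j, PowerSeries.C (rr j : ℚ) * F j (k + 1)) := by
    intro k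
    have h := walkGF_eq M (.inr (e, k)) (k + 2) (by
      intro j i hi
      exact hc0 k j i (by rintro ⟨_, h⟩; omega) (by rintro ⟨_, h⟩; omega) (by omega))
    have hsum : (∑ j, ∑ i ∈ Finset.range (k + 1),
        PowerSeries.C (M (.inr (e, k)) (.inr (j, i)) : ℚ) * walkGF M (.inr (j, i))) =
        (∑ i ∈ Finset.range k, F (s' e) i + PowerSeries.C (r e : ℚ) * F (s' e) k)
        + PowerSeries.C (rα' : ℚ) * F e k := by
      rw [Finset.sum_eq_add (s' e) e hee]
      · congr 1
        · rw [Finset.sum_range_succ,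
            Finset.sum_congr rfl (g := fun i => F (s' e) i) (fun i hi => by
              have := Finset.mem_range.1 hi
              rw [hc k i (by omega), if_pos this]; simp [F])]
          rw [hc k k le_rfl]
          simp [F]
        · rw [Finset.sum_eq_single k]
          · rw [hc2]
          · intro i hi' hi
            have := Finset.mem_range.1 hi'
            rw [hc0 k e i (fun h => hee h.1.symm) (fun h => hi h.2) (by omega)]; simp
          · simp
      · intro j _ hj
        refine Finset.sum_eq_zero fun i hi' => ?_
        have := Finset.mem_range.1 hi'
        rw [hc0 k j i (fun h => hj.1 h.1) (fun h => hj.2 h.1) (by omega)]; simp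
      · simp
      · simp
    simp only [Finset.sum_range_succ _ (k + 1)] at h
    rw [Finset.sum_add_distrib, hsum] at h
    simp only [hc3] at h
    simp only [F, B] at h ⊢
    refine h.trans ?_; ring
  have hGe : ∀ k, F e k ∈ S := by
    have hg := hG _ (s' e) rfl hee
    have hgood := GoodSeq.smul (hv rα') ((hB e).add (GoodSeq.smul ratX
          (((GoodSeq.psum hY hY0 hg).add (GoodSeq.smul (ratC (r e : ℚ)) hg)).add
            (GoodSeq.sum (Finset.univ.erase e) (fun j k => PowerSeries.C (rr j : ℚ) * F j (k + 1))
              (fun j hj => GoodSeq.smul (ratC (rr j : ℚ))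
                (hG _ j rfl (Finset.ne_of_mem_erase hj)).shift)))))
    refine GoodSeq.solve hYX hgood ?_
    intro k
    have h := hFe k
    rw [← Finset.add_sum_erase _ _ (Finset.mem_univ e)] at h
    rw [hYdef]
    linear_combination v rα' * h - F e k * hv1 rα'
  have hFS : ∀ j k, F j k ∈ S := by
    intro j k
    by_cases hj : j = e
    · rw [hj]; exact hGe k
    · exact (hG _ j rfl hj).mem hY k
  have hall := nakayama_rat S hfg (by
    intro a haS
    induction haS using Submodule.span_induction with
    | mem a h =>
      rcases h with rfl | ⟨w, rfl⟩
      · exact ⟨1, Subring.one_mem _, 0, S.zero_mem, by simp⟩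
      · refine ⟨1, Subring.one_mem _, _, ?_, walkGF_eq M (.inl w) 2 (fun j i hi => hd w j i hi)⟩
        exact S.add_mem (S.sum_mem fun w' _ => smul_memS S (ratC _) (hWS w'))
          (S.sum_mem fun j _ => S.sum_mem fun i _ => smul_memS S (ratC _) (hFS j i))
    | zero => exact ⟨0, Subring.zero_mem _, 0, S.zero_mem, by simp⟩
    | add a b _ _ iha ihb =>
      obtain ⟨c, hc, s, hs, rfl⟩ := iha
      obtain ⟨d, hd, t, ht, rfl⟩ := ihb
      exact ⟨c + d, Subring.add_mem _ hc hd, s + t, S.add_mem hs ht, by ring⟩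
    | smul q a _ iha =>
      obtain ⟨c, hc, s, hs, rfl⟩ := iha
      refine ⟨q * c, Subring.mul_mem _ q.2 hc, q * s, smul_memS S q.2 hs, ?_⟩
      change (q : PowerSeries ℚ) * _ = _
      ring)
  rcases hu with ⟨w, rfl⟩ | ⟨j, i, -, rfl⟩
  · exact hall _ (hWS w)
  · exact hall _ (hFS j i)
end

section
/- For every n ≥ 1, the number of permutations of [n] avoiding both of the patterns 123 and 43215 equals (3^{n−1} + 1)/2. -/
/-- `σ` contains the pattern `τ`. -/
def ContainsPat {n k : ℕ} (σ : Equiv.Perm (Fin n)) (τ : Equiv.Perm (Fin k)) : Prop :=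
  ∃ f : Fin k → Fin n, StrictMono f ∧ ∀ a b : Fin k, σ (f a) < σ (f b) ↔ τ a < τ b

/-- `σ` avoids every pattern in the set `B`. -/
def AvoidsAll {n : ℕ} (B : Set (Σ k, Equiv.Perm (Fin k))) (σ : Equiv.Perm (Fin n)) : Prop :=
  ∀ p ∈ B, ¬ ContainsPat σ p.2

/-- The pattern 123 (0-based one-line notation). -/
noncomputable def p123 : Equiv.Perm (Fin 3) :=
  Equiv.ofBijective ![0, 1, 2] (by decide)

/-- The pattern 43215 (0-based one-line notation). -/
noncomputable def p43215 : Equiv.Perm (Fin 5) :=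
  Equiv.ofBijective ![3, 2, 1, 0, 4] (by decide)

/-- Append a last entry of value `v` to `σ`. -/
def insLast {n : ℕ} (v : Fin (n+1)) (σ : Equiv.Perm (Fin n)) : Equiv.Perm (Fin (n+1)) :=
  ((finSuccEquiv' (Fin.last n)).trans (Equiv.optionCongr σ)).trans (finSuccEquiv' v).symm

theorem insLast_last {n : ℕ} (v : Fin (n+1)) (σ : Equiv.Perm (Fin n)) :
    insLast v σ (Fin.last n) = v := by
  simp [insLast]

theorem insLast_castSucc {n : ℕ} (v : Fin (n+1)) (σ : Equiv.Perm (Fin n)) (i : Fin n) :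
    insLast v σ i.castSucc = v.succAbove (σ i) := by
  have h : (finSuccEquiv' (Fin.last n)) i.castSucc = some i := by
    rw [← Fin.succAbove_last_apply, finSuccEquiv'_succAbove]
  simp [insLast, h]

theorem insLast_bij (n : ℕ) : Function.Bijective
    (fun p : Fin (n+1) × Equiv.Perm (Fin n) => insLast p.1 p.2) := by
  rw [Fintype.bijective_iff_injective_and_card]
  refine ⟨?_, ?_⟩
  · rintro ⟨v, σ⟩ ⟨w, τ⟩ h
    simp only at h
    have h1 : v = w := by rw [← insLast_last v σ, h, insLast_last]
    subst h1
    have h2 : σ = τ := by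
      ext i
      have := congrArg (fun e => e i.castSucc) h
      simp only [insLast_castSucc] at this
      rw [Fin.succAbove_right_injective this]
    rw [h2]
  · simp [Fintype.card_perm, Nat.factorial_succ]

/-- No increasing triple, no 43215. -/
def Good {n : ℕ} (σ : Equiv.Perm (Fin n)) : Prop :=
  (∀ i j k, i < j → j < k → σ i < σ j → σ j < σ k → False) ∧
  (∀ a b c d e, a < b → b < c → c < d → d < e →
    σ d < σ c → σ c < σ b → σ b < σ a → σ a < σ e → False)

/-- The `k` smallest values exist and occur in decreasing order. -/
def Dec {n : ℕ} (k : ℕ) (σ : Equiv.Perm (Fin n)) : Prop :=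
  k ≤ n ∧ ∀ i j, i < j → σ i < σ j → (σ j : ℕ) < k → False

theorem good_iff {n : ℕ} (σ : Equiv.Perm (Fin n)) :
    AvoidsAll ({⟨3, p123⟩, ⟨5, p43215⟩} : Set (Σ k, Equiv.Perm (Fin k))) σ ↔ Good σ := by
  have e1 : ContainsPat σ p123 ↔ ∃ i j k, i < j ∧ j < k ∧ σ i < σ j ∧ σ j < σ k := by
    constructor
    · rintro ⟨f, hf, h⟩
      refine ⟨f 0, f 1, f 2, hf (by decide), hf (by decide), (h 0 1).2 ?_, (h 1 2).2 ?_⟩ <;>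
      simp [p123]
    · rintro ⟨i, j, k, h1, h2, h3, h4⟩
      refine ⟨![i, j, k], ?_, ?_⟩
      · rw [Fin.strictMono_iff_lt_succ]
        intro a; fin_cases a <;> simp [h1, h2]
      · intro a b
        fin_cases a <;> fin_cases b <;> simp [p123] <;> order
  have e2 : ContainsPat σ p43215 ↔ ∃ a b c d e, a < b ∧ b < c ∧ c < d ∧ d < e ∧
      σ d < σ c ∧ σ c < σ b ∧ σ b < σ a ∧ σ a < σ e := by
    constructor
    · rintro ⟨f, hf, h⟩
      refine ⟨f 0, f 1, f 2, f 3, f 4, hf (by decide), hf (by decide), hf (by decide),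
        hf (by decide), (h 3 2).2 ?_, (h 2 1).2 ?_, (h 1 0).2 ?_, (h 0 4).2 ?_⟩ <;>
      simp [p43215] <;> decide
    · rintro ⟨a, b, c, d, e, h1, h2, h3, h4, h5, h6, h7, h8⟩
      refine ⟨![a, b, c, d, e], ?_, ?_⟩
      · rw [Fin.strictMono_iff_lt_succ]
        intro a; fin_cases a <;> simp [h1, h2, h3, h4]
      · intro x y
        fin_cases x <;> fin_cases y <;> simp [p43215, -Fin.val_fin_lt, Fin.lt_def] <;> omega
  simp only [AvoidsAll, Set.mem_insert_iff, Set.mem_singleton_iff, forall_eq_or_imp, forall_eq,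
    e1, e2, Good]
  push Not
  constructor
  · rintro ⟨h, h'⟩
    exact ⟨fun i j k a b c d => absurd d (not_lt.2 (h i j k a b c)),
      fun a b c d e q w r t y u i o => absurd o (not_lt.2 (h' a b c d e q w r t y u i))⟩
  · rintro ⟨h, h'⟩
    exact ⟨fun i j k a b c => not_lt.1 (fun d => h i j k a b c d),
      fun a b c d e q w r t y u i => not_lt.1 (fun o => h' a b c d e q w r t y u i o)⟩

theorem ins_lt {n : ℕ} (v : Fin (n+1)) (σ : Equiv.Perm (Fin n)) (i j : Fin n) :
    insLast v σ i.castSucc < insLast v σ j.castSucc ↔ σ i < σ j := by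
  rw [insLast_castSucc, insLast_castSucc, Fin.succAbove_lt_succAbove_iff]

theorem ins_val {n : ℕ} (v : Fin (n+1)) (σ : Equiv.Perm (Fin n)) (i : Fin n) :
    (insLast v σ i.castSucc : ℕ) = if (σ i : ℕ) < v then (σ i : ℕ) else σ i + 1 := by
  rw [insLast_castSucc, Fin.succAbove]
  simp only [Fin.lt_def, Fin.val_castSucc]
  split_ifs <;> simp

theorem ins_lt_last {n : ℕ} (v : Fin (n+1)) (σ : Equiv.Perm (Fin n)) (i : Fin n) :
    insLast v σ i.castSucc < insLast v σ (Fin.last n) ↔ (σ i : ℕ) < v := by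
  rw [Fin.lt_def, ins_val, insLast_last]
  split_ifs <;> omega

theorem lt_castSucc {n : ℕ} {x : Fin (n+1)} {y : Fin (n+1)} (h : x < y) :
    ∃ x' : Fin n, x = x'.castSucc :=
  ⟨⟨x, by have := y.2; rw [Fin.lt_def] at h; omega⟩, rfl⟩

theorem good_ins {n : ℕ} (v : Fin (n+1)) (σ : Equiv.Perm (Fin n)) :
    Good (insLast v σ) ↔ (Good σ ∧ Dec v σ ∧ (v : ℕ) ≤ 3) := by
  have hc : ∀ i : Fin n, i.castSucc < Fin.last n := Fin.castSucc_lt_last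
  constructor
  · rintro ⟨h, h'⟩
    have hD : Dec v σ := by
      refine ⟨by omega, fun i j hij h1 h2 => h i.castSucc j.castSucc (Fin.last n) ?_ (hc _)
        ((ins_lt ..).2 h1) ((ins_lt_last ..).2 h2)⟩
      exact hij
    refine ⟨⟨?_, ?_⟩, hD, ?_⟩
    · intro i j k h1 h2 h3 h4
      exact h i.castSucc j.castSucc k.castSucc h1 h2 ((ins_lt ..).2 h3) ((ins_lt ..).2 h4)
    · intro a b c d e h1 h2 h3 h4 h5 h6 h7 h8
      exact h' a.castSucc b.castSucc c.castSucc d.castSucc e.castSucc h1 h2 h3 h4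
        ((ins_lt ..).2 h5) ((ins_lt ..).2 h6) ((ins_lt ..).2 h7) ((ins_lt ..).2 h8)
    · by_contra hv
      have hv' := v.2
      have key : ∀ x y : Fin n, x < y → (y : ℕ) < v → σ.symm y < σ.symm x := by
        intro x y hxy hy
        rcases lt_trichotomy (σ.symm y) (σ.symm x) with hh | hh | hh
        · exact hh
        · exact absurd (σ.symm.injective hh) hxy.ne'
        · exact (hD.2 _ _ hh (by simpa using hxy) (by simpa using hy)).elim
      let f : (m : ℕ) → m < 4 → Fin n := fun m hm => ⟨m, by omega⟩
      refine h' (σ.symm (f 3 (by omega))).castSucc (σ.symm (f 2 (by omega))).castSucc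
        (σ.symm (f 1 (by omega))).castSucc (σ.symm (f 0 (by omega))).castSucc (Fin.last n)
        (key _ _ ?_ ?_) (key _ _ ?_ ?_) (key _ _ ?_ ?_) (hc _) ((ins_lt ..).2 ?_)
        ((ins_lt ..).2 ?_) ((ins_lt ..).2 ?_) ((ins_lt_last ..).2 ?_) <;>
      simp [f, Fin.lt_def] <;> omega
  · rintro ⟨⟨h, h'⟩, hD, hv⟩
    constructor
    · intro i j k h1 h2 h3 h4
      obtain ⟨i, rfl⟩ := lt_castSucc h1
      obtain ⟨j, rfl⟩ := lt_castSucc h2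
      rw [ins_lt] at h3
      induction k using Fin.lastCases with
      | last => exact hD.2 i j h1 h3 ((ins_lt_last ..).1 h4)
      | cast k => exact h i j k h1 h2 h3 ((ins_lt ..).1 h4)
    · intro a b c d e h1 h2 h3 h4 h5 h6 h7 h8
      obtain ⟨a, rfl⟩ := lt_castSucc h1
      obtain ⟨b, rfl⟩ := lt_castSucc h2
      obtain ⟨c, rfl⟩ := lt_castSucc h3
      obtain ⟨d, rfl⟩ := lt_castSucc h4
      rw [ins_lt] at h5 h6 h7
      induction e using Fin.lastCases with
      | last =>
        rw [ins_lt_last] at h8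
        rw [Fin.lt_def] at h5 h6 h7
        omega
      | cast e => exact h' a b c d e h1 h2 h3 h4 h5 h6 h7 ((ins_lt ..).1 h8)

theorem dec_ins {n : ℕ} (k : ℕ) (v : Fin (n+1)) (σ : Equiv.Perm (Fin n)) :
    Dec (k+1) (insLast v σ) ↔
      (((v : ℕ) = 0 ∧ Dec k σ) ∨ (k + 1 ≤ (v : ℕ) ∧ Dec (k+1) σ)) := by
  have hv' := v.2
  constructor
  · rintro ⟨hk, h⟩
    rcases Nat.eq_zero_or_pos (v : ℕ) with h0 | h0
    · refine Or.inl ⟨h0, by omega, fun i j hij h1 h2 => ?_⟩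
      refine h i.castSucc j.castSucc hij ((ins_lt ..).2 h1) ?_
      rw [ins_val, h0]; simpa using h2
    · have hkv : k + 1 ≤ (v : ℕ) := by
        by_contra hlt
        refine h (σ.symm ⟨0, by omega⟩).castSucc (Fin.last n) (Fin.castSucc_lt_last _)
          ((ins_lt_last ..).2 ?_) ?_
        · simpa using h0
        · rw [insLast_last]; omega
      refine Or.inr ⟨hkv, by omega, fun i j hij h1 h2 => ?_⟩
      refine h i.castSucc j.castSucc hij ((ins_lt ..).2 h1) ?_
      rw [ins_val, if_pos (by omega)]; exact h2
  · intro hh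
    refine ⟨by rcases hh with ⟨_, h, _⟩ | ⟨_, h, _⟩ <;> omega, ?_⟩
    intro i j hij h1 h2
    obtain ⟨i, rfl⟩ := lt_castSucc hij
    induction j using Fin.lastCases with
    | last =>
      rw [ins_lt_last] at h1
      rw [insLast_last] at h2
      omega
    | cast j =>
      rw [ins_lt] at h1
      rw [ins_val] at h2
      rcases hh with ⟨h0, h⟩ | ⟨h0, h⟩
      · refine h.2 i j hij h1 ?_
        split_ifs at h2 <;> omega
      · refine h.2 i j hij h1 ?_
        split_ifs at h2 <;> omega

theorem card_split {n : ℕ} (Q : Equiv.Perm (Fin (n+1)) → Prop) (g : ℕ → ℕ)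
    (hg : ∀ v : Fin (n+1), Nat.card {σ : Equiv.Perm (Fin n) // Q (insLast v σ)} = g v)
    (h1 : ∀ v, 4 ≤ v → g v = 0) (h2 : ∀ v, n < v → g v = 0) :
    Nat.card {σ // Q σ} = g 0 + g 1 + g 2 + g 3 := by
  have e : {p : Fin (n+1) × Equiv.Perm (Fin n) // Q (insLast p.1 p.2)} ≃ {σ // Q σ} :=
    (Equiv.ofBijective _ (insLast_bij n)).subtypeEquiv (fun _ => Iff.rfl)
  have e' : {p : Fin (n+1) × Equiv.Perm (Fin n) // Q (insLast p.1 p.2)} ≃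
      (Σ v : Fin (n+1), {σ : Equiv.Perm (Fin n) // Q (insLast v σ)}) :=
    { toFun := fun p => ⟨p.1.1, p.1.2, p.2⟩
      invFun := fun p => ⟨(p.1, p.2.1), p.2.2⟩
      left_inv := fun _ => rfl
      right_inv := fun _ => rfl }
  rw [← Nat.card_congr e, Nat.card_congr e', Nat.card_sigma, Finset.sum_congr rfl (fun v _ => hg v),
    Fin.sum_univ_eq_sum_range]
  have s1 : ∑ i ∈ Finset.range (n+1), g i = ∑ i ∈ Finset.range (n+1+4), g i := by
    refine Finset.sum_subset (Finset.range_mono (by omega)) (fun x _ hx => h2 x ?_)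
    simp at hx; omega
  have s2 : ∑ i ∈ Finset.range 4, g i = ∑ i ∈ Finset.range (n+1+4), g i := by
    refine Finset.sum_subset (Finset.range_mono (by omega)) (fun x _ hx => h1 x ?_)
    simpa using hx
  rw [s1, ← s2]
  simp [Finset.sum_range_succ]

/-- Number of good permutations whose `k` smallest values are decreasing. -/
noncomputable def cnt (n k : ℕ) : ℕ := Nat.card {σ : Equiv.Perm (Fin n) // Good σ ∧ Dec k σ}

theorem cnt_big {n k : ℕ} (h : n < k) : cnt n k = 0 := by
  have : IsEmpty {σ : Equiv.Perm (Fin n) // Good σ ∧ Dec k σ} :=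
    ⟨fun σ => by have := σ.2.2.1; omega⟩
  exact Nat.card_of_isEmpty

theorem dec_zero {n : ℕ} (σ : Equiv.Perm (Fin n)) : Dec 0 σ := ⟨by omega, by intros; omega⟩

theorem dec_one {n : ℕ} (hn : 1 ≤ n) (σ : Equiv.Perm (Fin n)) : Dec 1 σ :=
  ⟨hn, by intro i j _ h; rw [Fin.lt_def] at h; omega⟩

theorem dec_mono {n k l : ℕ} (h : k ≤ l) {σ : Equiv.Perm (Fin n)} (hd : Dec l σ) : Dec k σ :=
  ⟨h.trans hd.1, fun i j a b c => hd.2 i j a b (by omega)⟩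

theorem cnt_one {n : ℕ} (hn : 1 ≤ n) : cnt n 1 = cnt n 0 := by
  simp [cnt, dec_zero, dec_one hn]

theorem rec_zero (n : ℕ) : cnt (n+1) 0 = cnt n 0 + cnt n 1 + cnt n 2 + cnt n 3 := by
  rw [cnt, card_split _ (fun v => if v ≤ 3 then cnt n v else 0)]
  · simp
  · intro v
    simp only [good_ins, dec_zero, and_true]
    split_ifs with h
    · simp [h, cnt]
    · simp [h]
  · intro v hv; rw [if_neg (by omega)]
  · intro v hv; simp [cnt_big hv]

theorem rec_succ (n k : ℕ) : cnt (n+1) (k+1) = cnt n k +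
    (if k = 0 then cnt n 1 else 0) + (if k ≤ 1 then cnt n 2 else 0)
     + (if k < 3 then cnt n 3 else 0) := by
  rw [cnt, card_split _ (fun v => if v = 0 then cnt n k else
    if v ≤ 3 ∧ k + 1 ≤ v then cnt n v else 0)]
  · simp
  · intro v
    simp only [good_ins, dec_ins]
    split_ifs with h h'
    · simp [h, cnt, dec_zero]
    · simp only [h, cnt, h'.1, h'.2, true_and, and_true, false_and, false_or]
      refine Nat.card_congr (Equiv.subtypeEquivRight fun σ => ?_)
      exact ⟨fun h => h.1, fun h => ⟨h, dec_mono h'.2 h.2⟩⟩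
    · have : IsEmpty {σ : Equiv.Perm (Fin n) // (Good σ ∧ Dec v σ ∧ (v : ℕ) ≤ 3) ∧
          (((v : ℕ) = 0 ∧ Dec k σ) ∨ (k + 1 ≤ (v : ℕ) ∧ Dec (k+1) σ))} :=
        ⟨fun σ => by have := σ.2; tauto⟩
      exact Nat.card_of_isEmpty
  · intro v hv; rw [if_neg (by omega), if_neg (by omega)]
  · intro v hv; rw [if_neg (by omega)]; simp [cnt_big hv]

theorem cnt_main (n : ℕ) : 2 * cnt (n+1) 0 = 3 ^ n + 1 ∧
    cnt (n+1) 2 + cnt (n+1) 3 + 1 = cnt (n+1) 0 := by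
  induction n with
  | zero =>
    have h0 : cnt 0 0 = 1 := by
      have : ∀ σ : Equiv.Perm (Fin 0), Good σ := fun σ => ⟨fun i => i.elim0, fun i => i.elim0⟩
      simp [cnt, dec_zero, this]
    rw [rec_zero, cnt_big (n := 0 + 1) (k := 2) (by omega), cnt_big (n := 0 + 1) (k := 3) (by omega),
      h0, cnt_big (n := 0) (k := 1) (by omega), cnt_big (n := 0) (k := 2) (by omega),
      cnt_big (n := 0) (k := 3) (by omega)]
    simp
  | succ n ih =>
    have a := rec_zero (n+1)
    have b := rec_succ (n+1) 1
    have c := rec_succ (n+1) 2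
    have d := cnt_one (n := n+1) (by omega)
    simp at b c
    rw [pow_succ]
    omega

theorem card_avoiders_123_43215 (n : ℕ) (hn : 1 ≤ n) :
    2 * Nat.card {σ : Equiv.Perm (Fin n) //
        AvoidsAll ({⟨3, p123⟩, ⟨5, p43215⟩} : Set (Σ k, Equiv.Perm (Fin k))) σ} =
      3 ^ (n - 1) + 1 := by
  obtain ⟨m, rfl⟩ : ∃ m, n = m + 1 := ⟨n - 1, by omega⟩
  have h := (cnt_main m).1
  simp only [good_iff]
  simpa [cnt, dec_zero] using h
end

section
/- For every n ≥ 1, the number of permutations of [n] avoiding both of the patterns 123 and 132 equals 2^{n−1}. -/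
/-- The pattern 132 (0-based one-line notation). -/
noncomputable def p132 : Equiv.Perm (Fin 3) :=
  Equiv.ofBijective ![0, 2, 1] (by decide)

/-- Every entry has at most one later smaller entry. -/
def QProp {n : ℕ} (σ : Equiv.Perm (Fin n)) : Prop :=
  ∀ i j k : Fin n, i < j → j < k → σ j < σ i → σ k < σ i → False

theorem avoids_iff {n : ℕ} (σ : Equiv.Perm (Fin n)) :
    AvoidsAll ({⟨3, p123⟩, ⟨3, p132⟩} : Set (Σ k, Equiv.Perm (Fin k))) σ ↔
      QProp (σ.trans Fin.revPerm) := by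
  have h3 : ∀ i j k : Fin n, i < j → j < k → StrictMono ![i, j, k] := by
    intro i j k hij hjk a b hab
    have := hij.trans hjk
    fin_cases a <;> fin_cases b <;> simp_all
  constructor
  · intro h i j k hij hjk h1 h2
    simp only [Equiv.trans_apply, Fin.revPerm_apply, Fin.rev_lt_rev] at h1 h2
    rcases lt_trichotomy (σ j) (σ k) with h4 | h4 | h4
    · apply h ⟨3, p123⟩ (by simp)
      refine ⟨![i, j, k], h3 i j k hij hjk, ?_⟩
      intro a b
      fin_cases a <;> fin_cases b <;>
        simp [p123, h1, h2, h4, h1.le, h2.le, h4.le]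
    · exact hjk.ne (σ.injective h4)
    · apply h ⟨3, p132⟩ (by simp)
      refine ⟨![i, j, k], h3 i j k hij hjk, ?_⟩
      intro a b
      fin_cases a <;> fin_cases b <;>
        simp [p132, h1, h2, h4, h1.le, h2.le, h4.le]
  · intro h p hp
    have key : ∀ τ : Equiv.Perm (Fin 3), τ 0 < τ 1 → τ 0 < τ 2 → ¬ ContainsPat σ τ := by
      rintro τ h1 h2 ⟨f, hf, hs⟩
      refine h (f 0) (f 1) (f 2) (hf (by decide)) (hf (by decide)) ?_ ?_
      · simpa using (hs 0 1).2 h1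
      · simpa using (hs 0 2).2 h2
    rcases hp with rfl | rfl
    · exact key _ (by simp [p123]) (by simp [p123])
    · exact key _ (by simp [p132]) (by simp [p132])

theorem q_decomp {n : ℕ} (p : Fin (n + 2)) (e : Equiv.Perm (Fin (n + 1))) :
    QProp (Equiv.Perm.decomposeFin.symm (p, e)) ↔ p ≤ 1 ∧ QProp e := by
  constructor
  · intro h
    have hp : p ≤ 1 := by
      by_contra hp
      push Not at hp
      set σ := Equiv.Perm.decomposeFin.symm (p, e) with hσ
      have h0 : σ 0 = p := by simp [hσ]
      have pos : ∀ v : Fin (n + 2), v < p → 0 < σ.symm v := by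
        intro v hv
        rw [Fin.pos_iff_ne_zero]
        intro h1
        rw [Equiv.symm_apply_eq, h0] at h1
        exact hv.ne h1
      have p0 : (0 : Fin (n + 2)) < p := lt_trans (by simp) hp
      rcases lt_trichotomy (σ.symm 0) (σ.symm 1) with h4 | h4 | h4
      · exact h 0 _ _ (pos 0 p0) h4 (by simpa [h0] using p0) (by simpa [h0] using hp)
      · have := σ.symm.injective h4
        simp at this
      · exact h 0 _ _ (pos 1 hp) h4 (by simpa [h0] using hp) (by simpa [h0] using p0)
    refine ⟨hp, ?_⟩
    have mono : ∀ a b : Fin (n + 1), a < b →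
        Equiv.swap 0 p a.succ < Equiv.swap 0 p b.succ := by
      intro a b hab
      simp only [Equiv.swap_apply_def]
      simp only [Fin.ext_iff, Fin.lt_def, Fin.le_def] at *
      split_ifs <;> simp at * <;> omega
    intro i j k hij hjk h1 h2
    refine h i.succ j.succ k.succ (by simpa) (by simpa) ?_ ?_
    · simpa using mono _ _ h1
    · simpa using mono _ _ h2
  · rintro ⟨hp, he⟩
    have mono : ∀ a b : Fin (n + 1), 
        Equiv.swap 0 p a.succ < Equiv.swap 0 p b.succ → a < b := by
      intro a b
      simp only [Equiv.swap_apply_def]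
      simp only [Fin.ext_iff, Fin.lt_def, Fin.le_def] at *
      split_ifs <;> simp at * <;> omega
    have hz : ∀ a : Fin (n + 1), Equiv.swap 0 p a.succ < p → a.val = 0 := by
      intro a
      simp only [Equiv.swap_apply_def]
      simp only [Fin.ext_iff, Fin.lt_def, Fin.le_def] at *
      have h1 : ((1 : Fin (n + 2)) : ℕ) = 1 := rfl
      have h0 : ((0 : Fin (n + 2)) : ℕ) = 0 := rfl
      have ha := Fin.val_succ a
      split_ifs <;> omega
    intro i j k hij hjk h1 h2
    obtain ⟨j, rfl⟩ := Fin.exists_succ_eq.2 (Fin.ne_zero_of_lt hij)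
    obtain ⟨k, rfl⟩ := Fin.exists_succ_eq.2 (Fin.ne_zero_of_lt hjk)
    rcases Fin.eq_zero_or_eq_succ i with rfl | ⟨i, rfl⟩
    · simp only [Equiv.Perm.decomposeFin_symm_apply_zero,
        Equiv.Perm.decomposeFin_symm_apply_succ] at h1 h2
      have := e.injective (Fin.ext ((hz _ h1).trans (hz _ h2).symm))
      simp [this] at hjk
    · simp only [Equiv.Perm.decomposeFin_symm_apply_succ] at h1 h2
      exact he i j k (by simpa using hij) (by simpa using hjk) (mono _ _ h1) (mono _ _ h2)

theorem card_q (n : ℕ) : Nat.card {σ : Equiv.Perm (Fin (n + 1)) // QProp σ} = 2 ^ n := by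
  induction n with
  | zero =>
    have : ∀ σ : Equiv.Perm (Fin (0 + 1)), QProp σ := by
      intro σ i j k hij
      omega
    rw [Nat.card_congr (Equiv.subtypeUnivEquiv this)]
    simp
  | succ n ih =>
    have e1 : {σ : Equiv.Perm (Fin (n + 1 + 1)) // QProp σ} ≃
        {x : Fin (n + 2) × Equiv.Perm (Fin (n + 1)) // x.1 ≤ 1 ∧ QProp x.2} :=
      (Equiv.subtypeEquiv Equiv.Perm.decomposeFin.symm
        (fun x => (q_decomp x.1 x.2).symm)).symm
    have e2 := e1.trans (Equiv.subtypeProdEquivProd (p := fun a : Fin (n + 2) => a ≤ 1)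
      (q := fun e : Equiv.Perm (Fin (n + 1)) => QProp e))
    have h2 : Nat.card {a : Fin (n + 2) // a ≤ 1} = 2 := by
      change Nat.card (Set.Iic (1 : Fin (n + 2))) = 2
      simp
    rw [Nat.card_congr e2, Nat.card_prod, ih, h2, pow_succ, mul_comm]

theorem card_avoiders_123_132 (n : ℕ) (hn : 1 ≤ n) :
    Nat.card {σ : Equiv.Perm (Fin n) //
        AvoidsAll ({⟨3, p123⟩, ⟨3, p132⟩} : Set (Σ k, Equiv.Perm (Fin k))) σ} =
      2 ^ (n - 1) := by
  obtain ⟨m, rfl⟩ : ∃ m, n = m + 1 := ⟨n - 1, by omega⟩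
  rw [Nat.add_sub_cancel, ← card_q m]
  exact Nat.card_congr (Equiv.subtypeEquiv
    (Equiv.equivCongr (Equiv.refl _) Fin.revPerm) (fun σ => avoids_iff σ))
end

section
/- For every n ≥ 3, the number of permutations σ of [n] avoiding both of the patterns 123 and 132 and in which the entry 2 appears to the left of the entry 1 (i.e., σ^{-1}(2) < σ^{-1}(1)) equals 3·2^{n−3}. (Equivalently, the generating function F_{21}(x) = Σ_{n≥2} #{σ ∈ S_n({123,132}) : σ^{-1}(2) < σ^{-1}(1)} x^n equals x²(1+x)/(1−2x).) -/
/-- Every entry has at most one larger entry to its right, and 2 precedes 1. -/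
def GoodP {n : ℕ} (σ : Equiv.Perm (Fin n)) : Prop :=
  (∀ i j k, i < j → j < k → σ i < σ j → σ i < σ k → False) ∧
  ∀ i j, (σ i).val = 0 → (σ j).val = 1 → j < i

instance {n : ℕ} (σ : Equiv.Perm (Fin n)) : Decidable (GoodP σ) := by
  unfold GoodP; infer_instance

theorem goodP_iff (n : ℕ) (h0 : 0 < n) (h1 : 1 < n) (σ : Equiv.Perm (Fin n)) :
    (AvoidsAll ({⟨3, p123⟩, ⟨3, p132⟩} : Set (Σ k, Equiv.Perm (Fin k))) σ ∧
        σ.symm ⟨1, h1⟩ < σ.symm ⟨0, h0⟩) ↔ GoodP σ := by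
  unfold AvoidsAll GoodP
  refine and_congr ?_ ?_
  · constructor
    · intro h i j k hij hjk g1 h2
      have hik := hij.trans hjk
      have hm : StrictMono ![i, j, k] := by
        intro a b hab
        fin_cases a <;> fin_cases b <;> simp_all
      have hne : σ j ≠ σ k := fun e => hjk.ne (σ.injective e)
      rcases lt_or_gt_of_ne hne with h3 | h3
      · refine h ⟨3, p123⟩ (by simp) ⟨![i, j, k], hm, ?_⟩
        intro a b
        fin_cases a <;> fin_cases b <;> simp [p123, g1, h2, h3, g1.le, h2.le, h3.le]
      · refine h ⟨3, p132⟩ (by simp) ⟨![i, j, k], hm, ?_⟩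
        intro a b
        fin_cases a <;> fin_cases b <;> simp [p132, g1, h2, h3, g1.le, h2.le, h3.le]
    · rintro h p hp ⟨f, hf, hfp⟩
      rcases hp with rfl | hp
      · exact h (f 0) (f 1) (f 2) (hf (by decide)) (hf (by decide))
          ((hfp 0 1).2 (by simp [p123])) ((hfp 0 2).2 (by simp [p123]))
      · rw [Set.mem_singleton_iff] at hp
        subst hp
        exact h (f 0) (f 1) (f 2) (hf (by decide)) (hf (by decide))
          ((hfp 0 1).2 (by simp [p132])) ((hfp 0 2).2 (by simp [p132]))
  · constructor
    · intro h i j hi hj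
      have e1 : i = σ.symm ⟨0, h0⟩ := by
        rw [Equiv.eq_symm_apply]; exact Fin.ext hi
      have e2 : j = σ.symm ⟨1, h1⟩ := by
        rw [Equiv.eq_symm_apply]; exact Fin.ext hj
      rw [e1, e2]; exact h
    · intro h
      exact h _ _ (by simp) (by simp)

/-- Prepend the entry `p`, standardizing the others. -/
def insP {n : ℕ} (x : Fin (n + 1) × Equiv.Perm (Fin n)) : Equiv.Perm (Fin (n + 1)) :=
  ((finSuccEquiv' 0).trans (Equiv.optionCongr x.2)).trans (finSuccEquiv' x.1).symm

theorem insP_zero {n : ℕ} (p : Fin (n + 1)) (τ : Equiv.Perm (Fin n)) : insP (p, τ) 0 = p := by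
  simp [insP]

theorem insP_succ {n : ℕ} (p : Fin (n + 1)) (τ : Equiv.Perm (Fin n)) (i : Fin n) :
    insP (p, τ) i.succ = p.succAbove (τ i) := by
  have : finSuccEquiv' (0 : Fin (n + 1)) i.succ = some i := by
    simp
  simp [insP, this]

theorem insP_bij (n : ℕ) : Function.Bijective (insP (n := n)) := by
  rw [Fintype.bijective_iff_injective_and_card]
  constructor
  · rintro ⟨p, τ⟩ ⟨q, ρ⟩ h
    have h0 : p = q := by rw [← insP_zero p τ, h, insP_zero]
    subst h0
    have : τ = ρ := by
      ext1 i
      apply Fin.succAbove_right_injective (p := p)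
      rw [← insP_succ, h, insP_succ]
    rw [this]
  · exact Fintype.card_congr Equiv.Perm.decomposeFin.symm

theorem goodP_insP {n : ℕ} (hn : 3 ≤ n) (p : Fin (n + 1)) (τ : Equiv.Perm (Fin n)) :
    GoodP (insP (p, τ)) ↔ n - 1 ≤ p.val ∧ GoodP τ := by
  unfold GoodP
  constructor
  · rintro ⟨h1, h2⟩
    have hp : n - 1 ≤ p.val := by
      by_contra hlt
      have key : ∀ a b : Fin n, a < b → (τ a = ⟨n - 1, by omega⟩ ∨ τ a = ⟨n - 2, by omega⟩) →
          (τ b = ⟨n - 1, by omega⟩ ∨ τ b = ⟨n - 2, by omega⟩) → False := by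
        intro a b hab ha hb
        refine h1 0 a.succ b.succ (Fin.succ_pos a) (Fin.succ_lt_succ_iff.2 hab) ?_ ?_
        · rw [insP_zero, insP_succ, Fin.lt_succAbove_iff_le_castSucc, Fin.le_def]
          rcases ha with ha | ha <;> rw [ha] <;> simp <;> omega
        · rw [insP_zero, insP_succ, Fin.lt_succAbove_iff_le_castSucc, Fin.le_def]
          rcases hb with ha | ha <;> rw [ha] <;> simp <;> omega
      have hne : τ.symm ⟨n - 1, by omega⟩ ≠ τ.symm ⟨n - 2, by omega⟩ := by
        intro e
        have := congrArg Fin.val (τ.symm.injective e)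
        simp at this
        omega
      rcases lt_or_gt_of_ne hne with h | h
      · exact key _ _ h (by simp) (by simp)
      · exact key _ _ h (by simp) (by simp)
    refine ⟨hp, ?_, ?_⟩
    · intro i j k hij hjk hi hj
      refine h1 i.succ j.succ k.succ (Fin.succ_lt_succ_iff.2 hij) (Fin.succ_lt_succ_iff.2 hjk) ?_ ?_
      · rw [insP_succ, insP_succ]; exact Fin.succAbove_lt_succAbove_iff.2 hi
      · rw [insP_succ, insP_succ]; exact Fin.succAbove_lt_succAbove_iff.2 hj
    · intro i j hi hj
      rw [← Fin.succ_lt_succ_iff]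
      apply h2
      · rw [insP_succ, Fin.succAbove_of_castSucc_lt _ _ (by rw [Fin.lt_def]; simp; omega)]
        simpa using hi
      · rw [insP_succ, Fin.succAbove_of_castSucc_lt _ _ (by rw [Fin.lt_def]; simp; omega)]
        simpa using hj
  · rintro ⟨hp, h1, h2⟩
    have small : ∀ i : Fin n, ∀ c, c < 2 → (insP (p, τ) i.succ).val = c → (τ i).val = c := by
      intro i c hc h
      rw [insP_succ] at h
      unfold Fin.succAbove at h
      split_ifs at h with h'
      · simpa using h
      · rw [Fin.lt_def] at h'
        simp at h h'
        omega
    have big : ∀ i : Fin n, p < insP (p, τ) i.succ → (τ i).val = n - 1 := by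
      intro i h
      rw [insP_succ, Fin.lt_succAbove_iff_le_castSucc, Fin.le_def] at h
      have := (τ i).isLt
      simp at h
      omega
    constructor
    · intro i j k hij hjk hi hj
      obtain ⟨j, rfl⟩ := Fin.exists_succ_eq.2 (Fin.ne_zero_of_lt hij)
      obtain ⟨k, rfl⟩ := Fin.exists_succ_eq.2 (Fin.ne_zero_of_lt hjk)
      rw [Fin.succ_lt_succ_iff] at hjk
      rcases Fin.eq_zero_or_eq_succ i with rfl | ⟨i, rfl⟩
      · rw [insP_zero] at hi hj
        exact hjk.ne (τ.injective (Fin.ext ((big j hi).trans (big k hj).symm)))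
      · rw [Fin.succ_lt_succ_iff] at hij
        rw [insP_succ, insP_succ, Fin.succAbove_lt_succAbove_iff] at hi hj
        exact h1 i j k hij hjk hi hj
    · intro i j hi hj
      rcases Fin.eq_zero_or_eq_succ i with rfl | ⟨i, rfl⟩
      · rw [insP_zero] at hi; omega
      rcases Fin.eq_zero_or_eq_succ j with rfl | ⟨j, rfl⟩
      · exact Fin.succ_pos i
      · exact Fin.succ_lt_succ_iff.2 (h2 i j (small i 0 (by omega) hi) (small j 1 (by omega) hj))

theorem card_top_two (n : ℕ) (hn : 3 ≤ n) : Nat.card {p : Fin (n + 1) // n - 1 ≤ p.val} = 2 := by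
  have e : ({p : Fin (n + 1) | n - 1 ≤ p.val} : Finset _) =
      {⟨n - 1, by omega⟩, ⟨n, by omega⟩} := by
    ext p
    simp [Fin.ext_iff]
    omega
  rw [Nat.card_eq_fintype_card, Fintype.card_subtype, e, Finset.card_pair]
  simp [Fin.ext_iff]
  omega

theorem card_goodP (n : ℕ) (hn : 3 ≤ n) :
    Nat.card {σ : Equiv.Perm (Fin n) // GoodP σ} = 3 * 2 ^ (n - 3) := by
  induction n, hn using Nat.le_induction with
  | base => rw [Nat.card_eq_fintype_card]; decide +kernel
  | succ n hn ih =>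
    have e1 := Nat.card_congr ((Equiv.ofBijective _ (insP_bij n)).subtypeEquiv
      (p := fun x => n - 1 ≤ x.1.val ∧ GoodP x.2) (q := GoodP)
      (fun x => (goodP_insP hn x.1 x.2).symm))
    rw [← e1, Nat.card_congr (Equiv.subtypeProdEquivProd (p := fun x : Fin (n + 1) => n - 1 ≤ x.val)
      (q := fun x : Equiv.Perm (Fin n) => GoodP x)), Nat.card_prod, ih, card_top_two n hn,
      show n + 1 - 3 = (n - 3) + 1 by omega, pow_succ]
    ring

theorem card_avoiders_123_132_two_before_one (n : ℕ) (hn : 3 ≤ n) :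
    Nat.card {σ : Equiv.Perm (Fin n) //
        AvoidsAll ({⟨3, p123⟩, ⟨3, p132⟩} : Set (Σ k, Equiv.Perm (Fin k))) σ ∧
        σ.symm ⟨1, by omega⟩ < σ.symm ⟨0, by omega⟩} =
      3 * 2 ^ (n - 3) := by
  rw [← card_goodP n hn]
  exact Nat.card_congr (Equiv.subtypeEquivRight (goodP_iff n _ _))
end

section
/- Let a_n denote the number of permutations of [n] avoiding all three of the patterns 123, 1432 and 2143. Then a_1 = 1, a_2 = 2, and a_n = 2a_{n−1} + a_{n−2} for all n ≥ 3 (so a_n is the n-th Pell number, with generating function x/(1 − 2x − x²)). -/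
/-- The pattern 1432 (0-based one-line notation). -/
noncomputable def p1432 : Equiv.Perm (Fin 4) :=
  Equiv.ofBijective ![0, 3, 2, 1] (by decide)

/-- The pattern 2143 (0-based one-line notation). -/
noncomputable def p2143 : Equiv.Perm (Fin 4) :=
  Equiv.ofBijective ![1, 0, 3, 2] (by decide)

noncomputable def a9 (n : ℕ) : ℕ :=
  Nat.card {σ : Equiv.Perm (Fin n) //
    AvoidsAll ({⟨3, p123⟩, ⟨4, p1432⟩, ⟨4, p2143⟩} : Set (Σ k, Equiv.Perm (Fin k))) σ}

/-- First-order form of the avoidance condition. -/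
def Av {n : ℕ} (σ : Equiv.Perm (Fin n)) : Prop :=
  (∀ i j l : Fin n, i < j → j < l → σ i < σ j → σ j < σ l → False) ∧
  (∀ i j l p : Fin n, i < j → j < l → l < p → σ i < σ p → σ p < σ l → σ l < σ j → False) ∧
  (∀ i j l p : Fin n, i < j → j < l → l < p → σ j < σ i → σ i < σ p → σ p < σ l → False)

lemma contains123_iff {n : ℕ} (σ : Equiv.Perm (Fin n)) :
    ContainsPat σ p123 ↔ ∃ i j l : Fin n, i < j ∧ j < l ∧ σ i < σ j ∧ σ j < σ l := by
  constructor
  · rintro ⟨f, hf, h⟩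
    refine ⟨f 0, f 1, f 2, hf (by decide), hf (by decide), (h 0 1).2 ?_, (h 1 2).2 ?_⟩ <;>
      simp [p123]
  · rintro ⟨i, j, l, h1, h2, h3, h4⟩
    refine ⟨![i, j, l], ?_, ?_⟩
    · rw [Fin.strictMono_iff_lt_succ]
      intro a
      fin_cases a <;> simp [h1, h2]
    · intro a b
      fin_cases a <;> fin_cases b <;> simp [p123] <;> order

lemma contains1432_iff {n : ℕ} (σ : Equiv.Perm (Fin n)) :
    ContainsPat σ p1432 ↔ ∃ i j l p : Fin n, i < j ∧ j < l ∧ l < p ∧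
      σ i < σ p ∧ σ p < σ l ∧ σ l < σ j := by
  constructor
  · rintro ⟨f, hf, h⟩
    refine ⟨f 0, f 1, f 2, f 3, hf (by decide), hf (by decide), hf (by decide),
      (h 0 3).2 ?_, (h 3 2).2 ?_, (h 2 1).2 ?_⟩ <;>
      simp [p1432] <;> decide
  · rintro ⟨i, j, l, p, h1, h2, h0, h3, h4, h5⟩
    refine ⟨![i, j, l, p], ?_, ?_⟩
    · rw [Fin.strictMono_iff_lt_succ]
      intro a
      fin_cases a <;> simp [h1, h2, h0]
    · intro a b
      fin_cases a <;> fin_cases b <;> simp [p1432] <;> first | order | skip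

lemma contains2143_iff {n : ℕ} (σ : Equiv.Perm (Fin n)) :
    ContainsPat σ p2143 ↔ ∃ i j l p : Fin n, i < j ∧ j < l ∧ l < p ∧
      σ j < σ i ∧ σ i < σ p ∧ σ p < σ l := by
  constructor
  · rintro ⟨f, hf, h⟩
    refine ⟨f 0, f 1, f 2, f 3, hf (by decide), hf (by decide), hf (by decide),
      (h 1 0).2 ?_, (h 0 3).2 ?_, (h 3 2).2 ?_⟩ <;>
      simp [p2143] <;> decide
  · rintro ⟨i, j, l, p, h1, h2, h0, h3, h4, h5⟩
    refine ⟨![i, j, l, p], ?_, ?_⟩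
    · rw [Fin.strictMono_iff_lt_succ]
      intro a
      fin_cases a <;> simp [h1, h2, h0]
    · intro a b
      fin_cases a <;> fin_cases b <;> simp [p2143] <;> first | order | skip

lemma avoidsAll_iff {n : ℕ} (σ : Equiv.Perm (Fin n)) :
    AvoidsAll ({⟨3, p123⟩, ⟨4, p1432⟩, ⟨4, p2143⟩} : Set (Σ k, Equiv.Perm (Fin k))) σ ↔ Av σ := by
  simp only [AvoidsAll, Set.mem_insert_iff, Set.mem_singleton_iff, forall_eq_or_imp, forall_eq,
    contains123_iff, contains1432_iff, contains2143_iff, Av]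
  push Not
  refine and_congr ?_ (and_congr ?_ ?_) <;> simp only [← not_lt, ← imp_false] <;> tauto

/-- Insert a new first entry `k`. -/
def ins {n : ℕ} (k : Fin (n + 1)) (τ : Equiv.Perm (Fin n)) : Equiv.Perm (Fin (n + 1)) :=
  ((finSuccEquiv' 0).trans (Equiv.optionCongr τ)).trans (finSuccEquiv' k).symm

@[simp] lemma ins_zero {n : ℕ} (k : Fin (n + 1)) (τ : Equiv.Perm (Fin n)) : ins k τ 0 = k := by
  simp [ins]

@[simp] lemma ins_succ {n : ℕ} (k : Fin (n + 1)) (τ : Equiv.Perm (Fin n)) (i : Fin n) :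
    ins k τ i.succ = k.succAbove (τ i) := by
  have h : finSuccEquiv' (0 : Fin (n + 1)) i.succ = some i := by
    rw [← Fin.succAbove_zero_apply, finSuccEquiv'_succAbove]
  simp [ins, h]

lemma ins_bijective (n : ℕ) :
    Function.Bijective (fun x : Fin (n + 1) × Equiv.Perm (Fin n) => ins x.1 x.2) := by
  rw [Fintype.bijective_iff_injective_and_card]
  constructor
  · rintro ⟨k, τ⟩ ⟨k', τ'⟩ h
    simp only at h
    have h0 : k = k' := by simpa using congrArg (fun e => e 0) h
    subst h0
    congr 1
    ext i : 1
    have := congrArg (fun e => e i.succ) h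
    simpa using this
  · simp [Fintype.card_perm, Nat.factorial_succ]

lemma av_of_ins {n : ℕ} {k : Fin (n + 1)} {τ : Equiv.Perm (Fin n)} (h : Av (ins k τ)) : Av τ := by
  obtain ⟨h1, h2, h3⟩ := h
  refine ⟨fun i j l => ?_, fun i j l p => ?_, fun i j l p => ?_⟩
  · simpa using h1 i.succ j.succ l.succ
  · simpa using h2 i.succ j.succ l.succ p.succ
  · simpa using h3 i.succ j.succ l.succ p.succ

/-- To extend avoidance to `ins k τ` only occurrences using the first entry matter. -/
lemma av_ins {n : ℕ} {k : Fin (n + 1)} {τ : Equiv.Perm (Fin n)} (h : Av τ)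
    (h1 : ∀ j l : Fin n, j < l → k < k.succAbove (τ j) → τ j < τ l → False)
    (h2 : ∀ j l p : Fin n, j < l → l < p → k < k.succAbove (τ p) → τ p < τ l → τ l < τ j → False)
    (h3 : ∀ j l p : Fin n, j < l → l < p → k.succAbove (τ j) < k → k < k.succAbove (τ p) →
      τ p < τ l → False) : Av (ins k τ) := by
  obtain ⟨g1, g2, g3⟩ := h
  refine ⟨fun i j l a b => ?_, fun i j l p a b c => ?_, fun i j l p a b c => ?_⟩
  · obtain ⟨j, rfl⟩ := Fin.exists_succ_eq.2 (Fin.ne_zero_of_lt a)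
    obtain ⟨l, rfl⟩ := Fin.exists_succ_eq.2 (Fin.ne_zero_of_lt b)
    cases i using Fin.cases with
    | zero => simpa using h1 j l (by simpa using b)
    | succ i => simpa using g1 i j l (by simpa using a) (by simpa using b)
  · obtain ⟨j, rfl⟩ := Fin.exists_succ_eq.2 (Fin.ne_zero_of_lt a)
    obtain ⟨l, rfl⟩ := Fin.exists_succ_eq.2 (Fin.ne_zero_of_lt b)
    obtain ⟨p, rfl⟩ := Fin.exists_succ_eq.2 (Fin.ne_zero_of_lt c)
    cases i using Fin.cases with
    | zero => simpa using h2 j l p (by simpa using b) (by simpa using c)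
    | succ i => simpa using g2 i j l p (by simpa using a) (by simpa using b) (by simpa using c)
  · obtain ⟨j, rfl⟩ := Fin.exists_succ_eq.2 (Fin.ne_zero_of_lt a)
    obtain ⟨l, rfl⟩ := Fin.exists_succ_eq.2 (Fin.ne_zero_of_lt b)
    obtain ⟨p, rfl⟩ := Fin.exists_succ_eq.2 (Fin.ne_zero_of_lt c)
    cases i using Fin.cases with
    | zero => simpa using h3 j l p (by simpa using b) (by simpa using c)
    | succ i => simpa using g3 i j l p (by simpa using a) (by simpa using b) (by simpa using c)

lemma lt_succAbove_val {n : ℕ} {k : Fin (n + 1)} {x : Fin n} (h : k < k.succAbove x) :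
    k.val ≤ x.val := by
  rw [Fin.lt_succAbove_iff_le_castSucc] at h
  simpa [Fin.le_def] using h

/-- A first entry that is the largest or second largest is harmless. -/
lemma av_ins_large {n : ℕ} {k : Fin (n + 1)} {τ : Equiv.Perm (Fin n)} (hk : n ≤ k.val + 1)
    (h : Av τ) : Av (ins k τ) := by
  refine av_ins h ?_ ?_ ?_
  · intro j l _ a b
    have := lt_succAbove_val a
    have := (τ l).isLt
    rw [Fin.lt_def] at b
    omega
  · intro j l p _ _ a b _
    have := lt_succAbove_val a
    have := (τ l).isLt
    rw [Fin.lt_def] at b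
    omega
  · intro j l p _ _ _ a b
    have := lt_succAbove_val a
    have := (τ l).isLt
    rw [Fin.lt_def] at b
    omega

lemma av_ins_large_iff {n : ℕ} {k : Fin (n + 1)} {τ : Equiv.Perm (Fin n)} (hk : n ≤ k.val + 1) :
    Av (ins k τ) ↔ Av τ := ⟨av_of_ins, av_ins_large hk⟩

/-- Entries above the first one are decreasing. -/
lemma above_first {n : ℕ} {σ : Equiv.Perm (Fin (n + 1))} (h : Av σ) {x y : Fin (n + 1)}
    (hx : σ 0 < x) (hxy : x < y) : 0 < σ.symm y ∧ σ.symm y < σ.symm x := by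
  have hx0 : 0 < σ.symm x := by
    rw [Fin.pos_iff_ne_zero]
    intro h0
    rw [← h0] at hx
    simp at hx
  have hy0 : 0 < σ.symm y := by
    rw [Fin.pos_iff_ne_zero]
    intro h0
    rw [← h0] at hx
    simp only [Equiv.apply_symm_apply] at hx
    order
  refine ⟨hy0, ?_⟩
  by_contra hc
  have hne : σ.symm x ≠ σ.symm y := fun e => hxy.ne (σ.symm.injective e)
  exact h.1 0 (σ.symm x) (σ.symm y) hx0 (by order) (by simpa using hx) (by simpa using hxy)

lemma not_av_small {n : ℕ} {σ : Equiv.Perm (Fin (n + 1))} (hk : (σ 0).val + 3 < n + 1) :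
    ¬ Av σ := by
  intro h
  let x : Fin (n + 1) := ⟨(σ 0).val + 1, by omega⟩
  let y : Fin (n + 1) := ⟨(σ 0).val + 2, by omega⟩
  let z : Fin (n + 1) := ⟨(σ 0).val + 3, by omega⟩
  have h0 : σ 0 < x := by simp [x, Fin.lt_def]
  have h1 : x < y := by simp [x, y]
  have h2 : y < z := by simp [z, y]
  have a := above_first h h0 h1
  have b := above_first h (h0.trans h1) h2
  exact h.2.1 0 (σ.symm z) (σ.symm y) (σ.symm x) b.1 b.2 a.2 (by simpa using h0)
    (by simpa using h1) (by simpa using h2)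

lemma second_of_av {m : ℕ} {σ : Equiv.Perm (Fin (m + 3))} (hk : (σ 0).val = m) (h : Av σ) :
    σ 1 = Fin.last (m + 2) := by
  let x : Fin (m + 3) := ⟨m + 1, by omega⟩
  have hx : σ 0 < x := by simp [x, Fin.lt_def, hk]
  have hxy : x < Fin.last (m + 2) := by simp [x, Fin.lt_def]
  have a := above_first h hx hxy
  by_contra hc
  have h1 : (1 : Fin (m + 3)) < σ.symm (Fin.last (m + 2)) := by
    have hne : (1 : Fin (m + 3)) ≠ σ.symm (Fin.last (m + 2)) := by
      intro e; apply hc; rw [e]; simp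
    have := a.1
    rw [Fin.lt_def] at this ⊢
    rw [Ne, Fin.ext_iff] at hne
    simp at this hne ⊢
    omega
  have n0 : σ 1 ≠ σ 0 := fun e => by simpa using σ.injective e
  have n1 : σ 1 ≠ x := by
    intro e
    rw [← e] at a
    simp at a
    order
  refine h.2.2 0 1 (σ.symm (Fin.last (m + 2))) (σ.symm x) (by simp) h1 a.2 ?_ (by simpa using hx)
    (by simpa using hxy)
  rw [Fin.lt_def]
  rw [Ne, Fin.ext_iff] at n0 n1
  rw [Fin.ext_iff] at hc
  have := (σ 1).isLt
  simp [x] at n1 hc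
  omega

lemma av_ins_third_iff {m : ℕ} {k : Fin (m + 3)} (hk : k.val = m) (j : Fin (m + 2))
    (ρ : Equiv.Perm (Fin (m + 1))) :
    Av (ins k (ins j ρ)) ↔ j = Fin.last (m + 1) ∧ Av ρ := by
  constructor
  · intro h
    refine ⟨?_, av_of_ins (av_of_ins h)⟩
    have h1 := second_of_av (by simpa using hk) h
    rw [← Fin.succ_zero_eq_one, ins_succ, ins_zero] at h1
    by_contra hc
    have hj : j.val < m + 1 := by
      have := j.isLt
      rw [Fin.ext_iff] at hc
      simp at hc
      omega
    have := congrArg Fin.val h1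
    simp [Fin.succAbove] at this
    split_ifs at this <;> simp at this <;> omega
  · rintro ⟨rfl, h⟩
    have ht : Av (ins (Fin.last (m + 1)) ρ) := av_ins_large (by simp) h
    have key : ∀ i : Fin (m + 2), (ins (Fin.last (m + 1)) ρ i).val = m + 1 → i = 0 := by
      intro i hi
      apply (ins (Fin.last (m + 1)) ρ).injective
      rw [ins_zero, Fin.ext_iff, hi]
      simp
    refine av_ins ht ?_ ?_ ?_
    · intro j l hjl a b
      have := lt_succAbove_val a
      have := (ins (Fin.last (m + 1)) ρ l).isLt
      rw [Fin.lt_def] at b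
      have := key l (by omega)
      subst this
      simp at hjl
    · intro j l p _ _ a b c
      have := lt_succAbove_val a
      have := (ins (Fin.last (m + 1)) ρ j).isLt
      rw [Fin.lt_def] at b c
      omega
    · intro j l p hjl _ _ a b
      have := lt_succAbove_val a
      have := (ins (Fin.last (m + 1)) ρ l).isLt
      rw [Fin.lt_def] at b
      have := key l (by omega)
      subst this
      simp at hjl

lemma a9_eq (n : ℕ) : a9 n = Nat.card {σ : Equiv.Perm (Fin n) // Av σ} :=
  Nat.card_congr (Equiv.subtypeEquivRight fun σ => avoidsAll_iff σ)

/-- Splitting a count by the first entry. -/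
lemma card_split_s9 (n : ℕ) (P : Equiv.Perm (Fin (n + 1)) → Prop) :
    Nat.card {σ // P σ} = ∑ k : Fin (n + 1), Nat.card {τ : Equiv.Perm (Fin n) // P (ins k τ)} := by
  rw [← Nat.card_sigma]
  symm
  refine Nat.card_congr (Equiv.trans ?_
    ((Equiv.ofBijective _ (ins_bijective n)).subtypeEquiv
      (p := fun x => P (ins x.1 x.2)) (fun x => Iff.rfl)))
  exact
    { toFun := fun x => ⟨(x.1, x.2.1), x.2.2⟩
      invFun := fun x => ⟨x.1.1, x.1.2, x.2⟩
      left_inv := fun _ => rfl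
      right_inv := fun _ => rfl }

lemma card_large {n : ℕ} {k : Fin (n + 1)} (hk : n ≤ k.val + 1) :
    Nat.card {τ : Equiv.Perm (Fin n) // Av (ins k τ)} = a9 n := by
  rw [a9_eq]
  exact Nat.card_congr (Equiv.subtypeEquivRight fun τ => av_ins_large_iff hk)

lemma card_third {m : ℕ} {k : Fin (m + 3)} (hk : k.val = m) :
    Nat.card {τ : Equiv.Perm (Fin (m + 2)) // Av (ins k τ)} = a9 (m + 1) := by
  rw [card_split_s9, Finset.sum_eq_single (Fin.last (m + 1))]
  · rw [a9_eq]
    exact Nat.card_congr (Equiv.subtypeEquivRight fun ρ => by simp [av_ins_third_iff hk])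
  · intro j _ hj
    simp [av_ins_third_iff hk, hj]
  · simp

lemma a9_zero : a9 0 = 1 := by
  rw [a9_eq, Nat.card_eq_one_iff_unique]
  refine ⟨inferInstance, ⟨⟨1, ?_⟩⟩⟩
  exact ⟨fun i => i.elim0, fun i => i.elim0, fun i => i.elim0⟩

lemma a9_one : a9 1 = 1 := by
  rw [a9_eq, card_split_s9, Fin.sum_univ_one, card_large (by simp), a9_zero]

lemma a9_two : a9 2 = 2 := by
  rw [a9_eq, card_split_s9, Fin.sum_univ_two, card_large (by simp), card_large (by simp), a9_one]

lemma a9_rec (m : ℕ) : a9 (m + 3) = 2 * a9 (m + 2) + a9 (m + 1) := by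
  rw [a9_eq, card_split_s9, Fin.sum_univ_castSucc, Fin.sum_univ_castSucc, Fin.sum_univ_castSucc,
    card_large (k := Fin.last (m + 2)) (by simp),
    card_large (k := (Fin.last (m + 1)).castSucc) (by simp),
    card_third (k := (Fin.last m).castSucc.castSucc) (by simp), Finset.sum_eq_zero]
  · ring
  · intro i _
    have : IsEmpty {τ : Equiv.Perm (Fin (m + 2)) //
        Av (ins i.castSucc.castSucc.castSucc τ)} :=
      ⟨fun τ => not_av_small (by simp) τ.2⟩
    exact Nat.card_of_isEmpty

theorem card_avoiders_123_1432_2143 :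
    a9 1 = 1 ∧ a9 2 = 2 ∧ ∀ n : ℕ, 3 ≤ n → a9 n = 2 * a9 (n - 1) + a9 (n - 2) := by
  refine ⟨a9_one, a9_two, fun n hn => ?_⟩
  obtain ⟨m, rfl⟩ := Nat.exists_eq_add_of_le' hn
  exact a9_rec m
end

section
/- For every n ≥ 2, there is exactly one permutation σ of [n] avoiding both of the patterns 123 and 312 in which the entry 1 appears to the left of the entry 2 (i.e., σ^{-1}(1) < σ^{-1}(2)). (Equivalently, F_{12}(x) = Σ_{n≥2} #{σ ∈ S_n({123,312}) : σ^{-1}(1) < σ^{-1}(2)} x^n = x²/(1−x).) -/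
/-- The pattern 312 (0-based one-line notation). -/
noncomputable def p312 : Equiv.Perm (Fin 3) :=
  Equiv.ofBijective ![2, 0, 1] (by decide)

theorem contains_p123_iff {n : ℕ} (σ : Equiv.Perm (Fin n)) :
    ContainsPat σ p123 ↔ ∃ i j k, i < j ∧ j < k ∧ σ i < σ j ∧ σ j < σ k := by
  constructor
  · rintro ⟨f, hf, h⟩
    exact ⟨f 0, f 1, f 2, hf (by decide), hf (by decide),
      (h 0 1).2 (by simp [p123]), (h 1 2).2 (by simp [p123])⟩
  · rintro ⟨i, j, k, hij, hjk, h1, h2⟩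
    refine ⟨![i, j, k], ?_, ?_⟩
    · intro a b hab
      fin_cases a <;> fin_cases b <;> simp at hab ⊢ <;> order
    · intro a b
      fin_cases a <;> fin_cases b <;> simp [p123] <;> order

theorem contains_p312_iff {n : ℕ} (σ : Equiv.Perm (Fin n)) :
    ContainsPat σ p312 ↔ ∃ i j k, i < j ∧ j < k ∧ σ j < σ k ∧ σ k < σ i := by
  constructor
  · rintro ⟨f, hf, h⟩
    exact ⟨f 0, f 1, f 2, hf (by decide), hf (by decide),
      (h 1 2).2 (by simp [p312]), (h 2 0).2 (by simp [p312])⟩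
  · rintro ⟨i, j, k, hij, hjk, h1, h2⟩
    refine ⟨![i, j, k], ?_, ?_⟩
    · intro a b hab
      fin_cases a <;> fin_cases b <;> simp at hab ⊢ <;> order
    · intro a b
      fin_cases a <;> fin_cases b <;> simp [p312] <;> order

theorem val_neg_of_pos {m : ℕ} (x : Fin (m + 2)) (hx : 0 < x.val) :
    (-x).val = m + 2 - x.val := by
  rw [Fin.val_neg']
  exact Nat.mod_eq_of_lt (by omega)

theorem neg_lt_neg_of_pos {m : ℕ} {x y : Fin (m + 2)} (hx : 0 < x) (h : x < y) : -y < -x := by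
  have hx' : 0 < x.val := hx
  have h' : x.val < y.val := h
  rw [Fin.lt_def, val_neg_of_pos x hx', val_neg_of_pos y (by omega)]
  omega

theorem avoider_eq_neg {m : ℕ} (σ : Equiv.Perm (Fin (m + 2)))
    (h1 : ¬ ContainsPat σ p123) (h2 : ¬ ContainsPat σ p312)
    (h : σ.symm 0 < σ.symm 1) : σ = Equiv.neg (Fin (m + 2)) := by
  rw [contains_p123_iff] at h1
  rw [contains_p312_iff] at h2
  have h0 : σ 0 = 0 := by
    by_contra hne
    have ha : (0 : Fin (m + 2)) < σ.symm 0 := by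
      rw [Fin.pos_iff_ne_zero]
      intro he
      exact hne (by rw [← he, Equiv.apply_symm_apply, he])
    have hb : σ 0 ≠ 1 := by
      intro he
      rw [← he, Equiv.symm_apply_apply] at h
      exact absurd h (by simp)
    refine h2 ⟨0, σ.symm 0, σ.symm 1, ha, h, by simp, ?_⟩
    rw [Equiv.apply_symm_apply, Fin.lt_def]
    have e0 : (σ 0).val ≠ 0 := fun e => hne (Fin.ext e)
    have e1 : (σ 0).val ≠ 1 := fun e => hb (Fin.ext (by simpa using e))
    have : (1 : Fin (m + 2)).val = 1 := by simp
    omega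
  have hpos : ∀ i, 0 < i → 0 < σ i := by
    intro i hi
    rw [Fin.pos_iff_ne_zero]
    intro he
    rw [← h0] at he
    exact hi.ne' (σ.injective he)
  have hanti : ∀ i j, 0 < i → i < j → σ j < σ i := by
    intro i j hi hij
    by_contra hc
    have hlt : σ i < σ j := lt_of_le_of_ne (not_lt.1 hc) (fun e => hij.ne (σ.injective e))
    exact h1 ⟨0, i, j, hi, hij, by rw [h0]; exact hpos i hi, hlt⟩
  have hmono : StrictMono (fun i => - σ i) := by
    intro i j hij
    rcases (Fin.zero_le i).eq_or_lt with rfl | hi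
    · have := hpos j hij
      simp only [h0, neg_zero]
      rw [Fin.pos_iff_ne_zero] at this ⊢
      exact neg_ne_zero.2 this
    · exact neg_lt_neg_of_pos (hpos j (hi.trans hij)) (hanti i j hi hij)
  have hid : (fun i => - σ i) = id := by
    apply (hmono.range_inj strictMono_id).1
    rw [Set.range_id, Set.range_eq_univ]
    exact (Equiv.neg (Fin (m + 2))).surjective.comp σ.surjective
  ext1 i
  have := congrFun hid i
  simp only [id] at this
  rw [Equiv.neg_apply, ← neg_eq_iff_eq_neg, this]

theorem neg_avoids {m : ℕ} : ¬ ContainsPat (Equiv.neg (Fin (m + 2))) p123 ∧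
    ¬ ContainsPat (Equiv.neg (Fin (m + 2))) p312 := by
  rw [contains_p123_iff, contains_p312_iff]
  constructor
  · rintro ⟨i, j, k, hij, hjk, _, h⟩
    exact lt_asymm h (neg_lt_neg_of_pos ((Fin.zero_le i).trans_lt hij) hjk)
  · rintro ⟨i, j, k, hij, hjk, h, _⟩
    exact lt_asymm h (neg_lt_neg_of_pos ((Fin.zero_le i).trans_lt hij) hjk)

theorem card_avoiders_123_312_one_before_two (n : ℕ) (hn : 2 ≤ n) :
    Nat.card {σ : Equiv.Perm (Fin n) //
        AvoidsAll ({⟨3, p123⟩, ⟨3, p312⟩} : Set (Σ k, Equiv.Perm (Fin k))) σ ∧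
        σ.symm ⟨0, by omega⟩ < σ.symm ⟨1, by omega⟩} = 1 := by
  obtain ⟨m, rfl⟩ : ∃ m, n = m + 2 := ⟨n - 2, by omega⟩
  rw [Nat.card_eq_one_iff_exists]
  refine ⟨⟨Equiv.neg (Fin (m + 2)), ?_, ?_⟩, ?_⟩
  · rintro p (rfl | rfl)
    · exact neg_avoids.1
    · exact neg_avoids.2
  · change -(0 : Fin (m + 2)) < -(1 : Fin (m + 2))
    rw [neg_zero, Fin.pos_iff_ne_zero]
    exact neg_ne_zero.2 (by simp)
  · rintro ⟨σ, hσ, h⟩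
    apply Subtype.ext
    exact avoider_eq_neg σ (hσ ⟨3, p123⟩ (by simp)) (hσ ⟨3, p312⟩ (by simp)) h
end

section
/- For every n ≥ 2, the number of permutations σ of [n] avoiding both of the patterns 123 and 2143 in which the entry 2 appears to the left of the entry 1 (i.e., σ^{-1}(2) < σ^{-1}(1)) equals the Fibonacci number F_{2n−2}. -/
namespace Av123

/-- Elementary form of avoidance of 123 and 2143. -/
def Av {n : ℕ} (σ : Equiv.Perm (Fin n)) : Prop :=
  (∀ i j k : Fin n, i < j → j < k → σ i < σ j → σ j < σ k → False) ∧
  (∀ i j k l : Fin n, i < j → j < k → k < l → σ j < σ i → σ i < σ l → σ l < σ k → False)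

theorem contains123 {n : ℕ} (σ : Equiv.Perm (Fin n)) :
    ContainsPat σ p123 ↔ ∃ i j k : Fin n, i < j ∧ j < k ∧ σ i < σ j ∧ σ j < σ k := by
  constructor
  · rintro ⟨f, hf, h⟩
    refine ⟨f 0, f 1, f 2, hf (by decide), hf (by decide), (h 0 1).2 ?_, (h 1 2).2 ?_⟩ <;>
      simp [p123]
  · rintro ⟨i, j, k, hij, hjk, h1, h2⟩
    refine ⟨![i, j, k], ?_, ?_⟩
    · intro a b hab
      fin_cases a <;> fin_cases b <;> simp_all <;> omega
    · intro a b
      fin_cases a <;> fin_cases b <;> simp [p123] <;> omega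

theorem contains2143 {n : ℕ} (σ : Equiv.Perm (Fin n)) :
    ContainsPat σ p2143 ↔ ∃ i j k l : Fin n, i < j ∧ j < k ∧ k < l ∧
      σ j < σ i ∧ σ i < σ l ∧ σ l < σ k := by
  constructor
  · rintro ⟨f, hf, h⟩
    refine ⟨f 0, f 1, f 2, f 3, hf (by decide), hf (by decide), hf (by decide),
      (h 1 0).2 ?_, (h 0 3).2 ?_, (h 3 2).2 ?_⟩ <;>
      simp [p2143] <;> decide
  · rintro ⟨i, j, k, l, hij, hjk, hkl, h1, h2, h3⟩
    refine ⟨![i, j, k, l], ?_, ?_⟩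
    · intro a b hab
      fin_cases a <;> fin_cases b <;> simp_all <;> omega
    · intro a b
      fin_cases a <;> fin_cases b <;> simp [p2143] <;> first | omega | (simp [Fin.lt_def]; omega)

theorem avoidsAll_iff {n : ℕ} (σ : Equiv.Perm (Fin n)) :
    AvoidsAll ({⟨3, p123⟩, ⟨4, p2143⟩} : Set (Σ k, Equiv.Perm (Fin k))) σ ↔ Av σ := by
  have : AvoidsAll ({⟨3, p123⟩, ⟨4, p2143⟩} : Set (Σ k, Equiv.Perm (Fin k))) σ ↔
      ¬ ContainsPat σ p123 ∧ ¬ ContainsPat σ p2143 := by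
    simp [AvoidsAll]
  rw [this, contains123, contains2143]
  constructor
  · rintro ⟨h1, h2⟩
    exact ⟨fun i j k a b c d => h1 ⟨i, j, k, a, b, c, d⟩,
      fun i j k l a b c d e f => h2 ⟨i, j, k, l, a, b, c, d, e, f⟩⟩
  · rintro ⟨h1, h2⟩
    exact ⟨fun ⟨i, j, k, a, b, c, d⟩ => h1 i j k a b c d,
      fun ⟨i, j, k, l, a, b, c, d, e, f⟩ => h2 i j k l a b c d e f⟩

/-- Insert the value `v` at position `p`. -/
def ins {n : ℕ} (p v : Fin (n + 1)) (π : Equiv.Perm (Fin n)) : Equiv.Perm (Fin (n + 1)) :=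
  (finSuccEquiv' p).trans ((Equiv.optionCongr π).trans (finSuccEquiv' v).symm)

theorem ins_self {n : ℕ} (p v : Fin (n + 1)) (π : Equiv.Perm (Fin n)) : ins p v π p = v := by
  simp [ins]

theorem ins_succAbove {n : ℕ} (p v : Fin (n + 1)) (π : Equiv.Perm (Fin n)) (i : Fin n) :
    ins p v π (p.succAbove i) = v.succAbove (π i) := by
  simp [ins]

theorem ins_injective {n : ℕ} (p v : Fin (n + 1)) : Function.Injective (ins p v) := by
  intro π ρ h
  ext i
  have := congrArg (fun s : Equiv.Perm (Fin (n + 1)) => s (p.succAbove i)) h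
  simp only [ins_succAbove] at this
  rw [Fin.succAbove_right_injective this]

theorem ins_surj {n : ℕ} (p v : Fin (n + 1)) (σ : Equiv.Perm (Fin (n + 1))) (h : σ p = v) :
    ∃ π, ins p v π = σ := by
  have h1 : ∀ i : Fin n, ∃ j : Fin n, v.succAbove j = σ (p.succAbove i) := by
    intro i
    apply Fin.exists_succAbove_eq
    rw [← h]
    exact fun e => Fin.succAbove_ne p i (σ.injective e)
  choose f hf using h1
  have hinj : Function.Injective f := by
    intro a b hab
    have := hf a
    rw [hab, hf b] at this
    exact (Fin.succAbove_right_injective (σ.injective this)).symm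
  refine ⟨Equiv.ofBijective f (Finite.injective_iff_bijective.1 hinj), ?_⟩
  apply Equiv.ext
  intro x
  rcases Fin.eq_self_or_eq_succAbove p x with rfl | ⟨i, rfl⟩
  · rw [ins_self, h]
  · rw [ins_succAbove, ← hf]; rfl

theorem card_ins {n : ℕ} (p v : Fin (n + 1)) (P : Equiv.Perm (Fin (n + 1)) → Prop) :
    Nat.card {σ : Equiv.Perm (Fin (n + 1)) // P σ ∧ σ p = v} =
      Nat.card {π : Equiv.Perm (Fin n) // P (ins p v π)} := by
  symm
  refine Nat.card_congr (Equiv.ofBijective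
    (fun π => ⟨ins p v π.1, π.2, ins_self p v π.1⟩) ⟨?_, ?_⟩)
  · rintro ⟨a, ha⟩ ⟨b, hb⟩ h
    simp only [Subtype.mk.injEq] at h
    exact Subtype.ext (ins_injective p v h)
  · rintro ⟨σ, h1, h2⟩
    obtain ⟨π, rfl⟩ := ins_surj p v σ h2
    exact ⟨⟨π, h1⟩, rfl⟩

theorem ins_lt {n : ℕ} (p v : Fin (n + 1)) (π : Equiv.Perm (Fin n)) (i j : Fin n) :
    ins p v π (p.succAbove i) < ins p v π (p.succAbove j) ↔ π i < π j := by
  rw [ins_succAbove, ins_succAbove, Fin.succAbove_lt_succAbove_iff]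

theorem av_ins {n : ℕ} (p v : Fin (n + 1)) (π : Equiv.Perm (Fin n))
    (h : (n ≤ p.val + 1 ∧ v.val = 0) ∨ (p.val = n ∧ v.val ≤ 1)) :
    Av (ins p v π) ↔ Av π := by
  constructor
  · rintro ⟨h1, h2⟩
    constructor
    · intro i j k a b c d
      exact h1 (p.succAbove i) (p.succAbove j) (p.succAbove k) (by simpa) (by simpa)
        (by simpa [ins_lt]) (by simpa [ins_lt])
    · intro i j k l a b c d e f
      exact h2 (p.succAbove i) (p.succAbove j) (p.succAbove k) (p.succAbove l)
        (by simpa) (by simpa) (by simpa)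
        (by simpa [ins_lt]) (by simpa [ins_lt]) (by simpa [ins_lt])
  · rintro ⟨h1, h2⟩
    have hp := ins_self p v π
    constructor
    · intro i j k a b c d
      by_cases hi : i = p
      · subst hi; omega
      by_cases hj : j = p
      · subst hj; rw [hp] at c d; omega
      by_cases hk : k = p
      · subst hk; rw [hp] at d; omega
      obtain ⟨i, rfl⟩ := Fin.exists_succAbove_eq hi
      obtain ⟨j, rfl⟩ := Fin.exists_succAbove_eq hj
      obtain ⟨k, rfl⟩ := Fin.exists_succAbove_eq hk
      rw [ins_lt] at c d
      exact h1 i j k (by simpa using a) (by simpa using b) c d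
    · intro i j k l a b c d e f
      by_cases hi : i = p
      · subst hi; omega
      by_cases hj : j = p
      · subst hj; omega
      by_cases hk : k = p
      · subst hk; rw [hp] at f; omega
      by_cases hl : l = p
      · subst hl; rw [hp] at e; omega
      obtain ⟨i, rfl⟩ := Fin.exists_succAbove_eq hi
      obtain ⟨j, rfl⟩ := Fin.exists_succAbove_eq hj
      obtain ⟨k, rfl⟩ := Fin.exists_succAbove_eq hk
      obtain ⟨l, rfl⟩ := Fin.exists_succAbove_eq hl
      rw [ins_lt] at d e f
      exact h2 i j k l (by simpa using a) (by simpa using b) (by simpa using c) d e f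

/-- Number of avoiders. -/
noncomputable def a (n : ℕ) : ℕ := Nat.card {σ : Equiv.Perm (Fin n) // Av σ}

/-- Number of avoiders with the second smallest value before the smallest. -/
noncomputable def b (m : ℕ) : ℕ :=
  Nat.card {σ : Equiv.Perm (Fin (m + 2)) // Av σ ∧ σ.symm 1 < σ.symm 0}

theorem card_ins_av {n : ℕ} (p v : Fin (n + 1))
    (h : (n ≤ p.val + 1 ∧ v.val = 0) ∨ (p.val = n ∧ v.val ≤ 1)) :
    Nat.card {σ : Equiv.Perm (Fin (n + 1)) // Av σ ∧ σ p = v} = a n := by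
  rw [card_ins]
  simp only [av_ins p v _ h]
  rfl

theorem card_split {α : Type*} [Finite α] (P Q : α → Prop) :
    Nat.card {x // P x} = Nat.card {x // P x ∧ Q x} + Nat.card {x // P x ∧ ¬ Q x} := by
  classical
  have := Fintype.ofFinite α
  simp only [Nat.card_eq_fintype_card, Fintype.card_subtype]
  rw [← Finset.card_filter_add_card_filter_not (s := Finset.univ.filter P) Q,
    Finset.filter_filter, Finset.filter_filter]

theorem rec1 (m : ℕ) : a (m + 2) = a (m + 1) + b m := by
  rw [a, card_split _ (fun σ => σ (Fin.last (m + 1)) = 1),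
    card_ins_av _ _ (Or.inr ⟨by simp, by simp⟩), b]
  congr 1
  apply Nat.card_congr
  apply Equiv.subtypeEquivRight
  intro σ
  refine and_congr_right fun hA => ?_
  have h01 : σ.symm 0 ≠ σ.symm 1 := by
    intro e; have := σ.symm.injective e; simp at this
  constructor
  · intro hl
    by_contra hc
    apply hl
    have hlt : σ.symm 0 < σ.symm 1 := lt_of_le_of_ne (not_lt.1 hc) h01
    have : σ.symm 1 = Fin.last (m + 1) := by
      by_contra hne
      have hlt2 : σ.symm 1 < Fin.last (m + 1) := Fin.lt_last_iff_ne_last.2 hne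
      refine hA.1 _ _ _ hlt hlt2 (by simp) ?_
      have e0 : σ (Fin.last (m + 1)) ≠ 0 := by
        intro e; rw [← e] at hlt; simp at hlt; omega
      have e1 : σ (Fin.last (m + 1)) ≠ 1 := hl
      rw [Equiv.apply_symm_apply]
      have e0' : (σ (Fin.last (m + 1))).val ≠ 0 := fun e => e0 (Fin.ext e)
      have e1' : (σ (Fin.last (m + 1))).val ≠ 1 := fun e => e1 (Fin.ext (by simpa using e))
      rw [Fin.lt_def, Fin.val_one]; omega
    rw [← this]; simp
  · intro hlt e
    rw [← e, Equiv.symm_apply_apply] at hlt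
    exact absurd hlt (not_lt.2 (Fin.le_last _))

/-- The second to last position. -/
def q (m : ℕ) : Fin (m + 2) := ⟨m, by omega⟩

theorem mem_b (m : ℕ) (σ : Equiv.Perm (Fin (m + 2))) (hA : Av σ) :
    σ.symm 1 < σ.symm 0 ↔ σ (Fin.last (m + 1)) = 0 ∨ (σ (q m) = 0 ∧ σ (Fin.last (m + 1)) ≠ 1) := by
  have h01 : σ.symm 1 ≠ σ.symm 0 := by
    intro e; have := σ.symm.injective e; simp at this
  constructor
  · intro hlt
    by_cases h1 : σ.symm 0 = Fin.last (m + 1)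
    · left; rw [← h1]; simp
    by_cases h2 : σ.symm 0 = q m
    · right
      refine ⟨by rw [← h2]; simp, fun e => ?_⟩
      rw [← e, Equiv.symm_apply_apply] at hlt
      exact absurd hlt (not_lt.2 (Fin.le_last _))
    exfalso
    have h1' : (σ.symm 0).val ≠ m + 1 := fun e => h1 (Fin.ext e)
    have h2' : (σ.symm 0).val ≠ m := fun e => h2 (Fin.ext e)
    have h3 : σ.symm 0 < q m := by
      rw [Fin.lt_def]; simp only [q]; omega
    have h4 : q m < Fin.last (m + 1) := by
      rw [Fin.lt_def]; simp [q]
    have big : ∀ x, σ.symm 0 < x → 1 < σ x := by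
      intro x hx
      have e0' : (σ x).val ≠ 0 := by
        intro e
        have : σ x = 0 := Fin.ext e
        rw [← this, Equiv.symm_apply_apply] at hx
        exact lt_irrefl _ hx
      have e1' : (σ x).val ≠ 1 := by
        intro e
        have : σ x = 1 := Fin.ext (by simpa using e)
        rw [← this, Equiv.symm_apply_apply] at hlt
        exact lt_asymm hx hlt
      rw [Fin.lt_def, Fin.val_one]; omega
    have b1 := big _ h3
    have b2 := big _ (h3.trans h4)
    rcases lt_trichotomy (σ (q m)) (σ (Fin.last (m + 1))) with h | h | h
    · refine hA.1 _ _ _ h3 h4 ?_ h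
      rw [Equiv.apply_symm_apply]
      exact lt_of_le_of_lt (Fin.zero_le _) b1
    · exact h4.ne (σ.injective h)
    · refine hA.2 _ _ _ _ hlt h3 h4 ?_ ?_ h
      · simp
      · simpa using b2
  · rintro (h | ⟨h, h'⟩)
    · have : σ.symm 0 = Fin.last (m + 1) := by rw [← h]; simp
      rw [this] at h01 ⊢
      exact Fin.lt_last_iff_ne_last.2 h01
    · have : σ.symm 0 = q m := by rw [← h]; simp
      rw [this] at h01 ⊢
      have h2 : σ.symm 1 ≠ Fin.last (m + 1) := by
        intro e; apply h'; rw [← e]; simp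
      have h1' : (σ.symm 1).val ≠ m + 1 := fun e => h2 (Fin.ext e)
      have h2' : (σ.symm 1).val ≠ m := fun e => h01 (Fin.ext e)
      rw [Fin.lt_def]; simp only [q]; omega

theorem ins_q_last (m : ℕ) (π : Equiv.Perm (Fin (m + 1))) :
    ins (q m) 0 π (Fin.last (m + 1)) = 1 ↔ π (Fin.last m) = 0 := by
  have : Fin.last (m + 1) = (q m).succAbove (Fin.last m) := by
    rw [Fin.succAbove_of_le_castSucc]
    · simp
    · simp [Fin.le_def, q]
  rw [this, ins_succAbove, Fin.succAbove_zero, ← Fin.succ_zero_eq_one, Fin.succ_inj]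

theorem rec2 (m : ℕ) : b m + a m = 2 * a (m + 1) := by
  have e1 : b m = Nat.card {σ : Equiv.Perm (Fin (m + 2)) // Av σ ∧ σ (Fin.last (m + 1)) = 0} +
      Nat.card {σ : Equiv.Perm (Fin (m + 2)) //
        (Av σ ∧ σ (q m) = 0) ∧ ¬ σ (Fin.last (m + 1)) = 1} := by
    rw [b, card_split _ (fun σ => σ (Fin.last (m + 1)) = 0)]
    congr 1
    · apply Nat.card_congr
      apply Equiv.subtypeEquivRight
      intro σ
      constructor
      · rintro ⟨⟨hA, _⟩, h⟩; exact ⟨hA, h⟩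
      · rintro ⟨hA, h⟩; exact ⟨⟨hA, (mem_b m σ hA).2 (Or.inl h)⟩, h⟩
    · apply Nat.card_congr
      apply Equiv.subtypeEquivRight
      intro σ
      constructor
      · rintro ⟨⟨hA, h1⟩, h⟩
        rcases (mem_b m σ hA).1 h1 with h2 | h2
        · exact absurd h2 h
        · exact ⟨⟨hA, h2.1⟩, h2.2⟩
      · rintro ⟨⟨hA, h⟩, h'⟩
        refine ⟨⟨hA, (mem_b m σ hA).2 (Or.inr ⟨h, h'⟩)⟩, fun e => ?_⟩
        have := σ.injective (e.trans h.symm)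
        have := congrArg Fin.val this
        simp [q] at this
  have e2 := card_split (fun σ : Equiv.Perm (Fin (m + 2)) => Av σ ∧ σ (q m) = 0)
    (fun σ => σ (Fin.last (m + 1)) = 1)
  have hq : (m + 1 ≤ (q m).val + 1 ∧ (0 : Fin (m + 2)).val = 0) ∨
    ((q m).val = m + 1 ∧ (0 : Fin (m + 2)).val ≤ 1) := Or.inl ⟨by simp [q], rfl⟩
  rw [card_ins_av _ _ hq] at e2
  have e3 : Nat.card {σ : Equiv.Perm (Fin (m + 2)) //
        (Av σ ∧ σ (q m) = 0) ∧ σ (Fin.last (m + 1)) = 1} = a m := by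
    have : Nat.card {σ : Equiv.Perm (Fin (m + 2)) //
        (Av σ ∧ σ (q m) = 0) ∧ σ (Fin.last (m + 1)) = 1} =
        Nat.card {σ : Equiv.Perm (Fin (m + 2)) //
        (Av σ ∧ σ (Fin.last (m + 1)) = 1) ∧ σ (q m) = 0} :=
      Nat.card_congr (Equiv.subtypeEquivRight fun σ => by tauto)
    rw [this, card_ins (q m) 0 (fun σ => Av σ ∧ σ (Fin.last (m + 1)) = 1)]
    simp only [av_ins _ _ _ hq, ins_q_last]
    exact card_ins_av _ _ (Or.inl ⟨by simp, rfl⟩)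
  rw [card_ins_av _ _ (Or.inl ⟨by simp, rfl⟩)] at e1
  omega

theorem a_small {n : ℕ} (hn : n ≤ 1) : a n = 1 := by
  have hs : Subsingleton (Fin n) := by
    constructor; intro x y; apply Fin.ext; omega
  have : Nonempty {σ : Equiv.Perm (Fin n) // Av σ} :=
    ⟨⟨1, fun i j _ h => absurd h (by simp [Subsingleton.elim i j]),
      fun i j _ _ h => absurd h (by simp [Subsingleton.elim i j])⟩⟩
  rw [a, Nat.card_eq_one_iff_unique]
  exact ⟨inferInstance, this⟩

theorem main (m : ℕ) : a (m + 1) = Nat.fib (2 * m + 1) ∧ b m = Nat.fib (2 * m + 2) := by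
  induction m with
  | zero =>
    have h := rec2 0
    rw [a_small (le_refl 1), a_small (Nat.zero_le 1)] at h
    refine ⟨by rw [a_small (le_refl _)]; rfl, ?_⟩
    simp; omega
  | succ m ih =>
    obtain ⟨h1, h2⟩ := ih
    have r1 := rec1 m
    have r2 := rec2 (m + 1)
    have f1 : Nat.fib (2 * m + 3) = Nat.fib (2 * m + 1) + Nat.fib (2 * m + 2) := Nat.fib_add_two
    have f2 : Nat.fib (2 * m + 4) = Nat.fib (2 * m + 2) + Nat.fib (2 * m + 3) := Nat.fib_add_two
    have g1 : 2 * (m + 1) + 1 = 2 * m + 3 := by ring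
    have g2 : 2 * (m + 1) + 2 = 2 * m + 4 := by ring
    rw [g1, g2]
    rw [show m + 1 + 1 = m + 2 from rfl] at *
    omega

end Av123

theorem card_avoiders_123_2143_two_before_one (n : ℕ) (hn : 2 ≤ n) :
    Nat.card {σ : Equiv.Perm (Fin n) //
        AvoidsAll ({⟨3, p123⟩, ⟨4, p2143⟩} : Set (Σ k, Equiv.Perm (Fin k))) σ ∧
        σ.symm ⟨1, by omega⟩ < σ.symm ⟨0, by omega⟩} =
      Nat.fib (2 * n - 2) := by
  obtain ⟨m, rfl⟩ : ∃ m, n = m + 2 := ⟨n - 2, by omega⟩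
  have h := (Av123.main m).2
  rw [show 2 * (m + 2) - 2 = 2 * m + 2 by omega, ← h, Av123.b]
  simp only [Av123.avoidsAll_iff]
  rfl
end
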